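/- arXiv:0810.3110 — 3 statements merged into one kernel-verified Lean document; each statement's English description precedes it below -/
import Mathlib

section
/- Two projections theorem, part (a): For each z in the spectrum sp_B x of x in B and each complex number w with w² = z(1−z), there exists a continuous unital algebra homomorphism σ_z : A → ℂ^{2N×2N} such that σ_z(θ(c)) is the block matrix [[c, O],[O, c]] for every c ∈ ℂ^{N×N}, σ_z(r) = [[E, O],[O, O]], and σ_z(s) = [[zE, wE],[wE, (1−z)E]], where E and O denote the N×N identity and zero matrices. -/
section Auxiliary

variable {B : Type*} [NormedRing B] [NormedAlgebra ℂ B]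

/-- A subalgebra of `B × M` on which the second coordinate is bounded by the first is the graph of
an algebra homomorphism, which extends continuously to the closure of its domain. -/
theorem Subalgebra.exists_continuous_algHom_of_graph {M : Type*} [NormedRing M] [NormedAlgebra ℂ M]
    [CompleteSpace M] (G : Subalgebra ℂ (B × M)) (K : ℝ) (hG : ∀ p ∈ G, ‖p.2‖ ≤ K * ‖p.1‖) :
    ∃ σ : (G.map (AlgHom.fst ℂ B M)).topologicalClosure →ₐ[ℂ] M,
      Continuous σ ∧ ∀ p ∈ G, ∀ a : (G.map (AlgHom.fst ℂ B M)).topologicalClosure,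
        (a : B) = p.1 → σ a = p.2 := by
  set A := (G.map (AlgHom.fst ℂ B M)).topologicalClosure
  have hbound : ∀ p ∈ G.topologicalClosure, ‖p.2‖ ≤ K * ‖p.1‖ := by
    have hclosed : IsClosed {p : B × M | ‖p.2‖ ≤ K * ‖p.1‖} :=
      isClosed_le (by fun_prop) (by fun_prop)
    exact fun p hp => closure_minimal hG hclosed hp
  have hmem : ∀ p ∈ G.topologicalClosure, p.1 ∈ A := fun p hp =>
    map_mem_closure continuous_fst hp fun q hq => ⟨q, hq, rfl⟩
  have hsurj : ∀ a ∈ A, ∃ m, (a, m) ∈ G.topologicalClosure := by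
    intro a ha
    obtain ⟨u, hu, hlim⟩ := mem_closure_iff_seq_limit.1 ha
    choose p hp hpu using hu
    have hpu' : ∀ n, (p n).1 = u n := hpu
    have hcau : CauchySeq fun n => (p n).2 := by
      have hu' := Metric.cauchySeq_iff.1 hlim.cauchySeq
      rw [Metric.cauchySeq_iff]
      intro ε hε
      obtain ⟨n₀, hn₀⟩ := hu' (ε / (|K| + 1)) (by positivity)
      refine ⟨n₀, fun m hm n hn => ?_⟩
      have h1 := hG _ (sub_mem (hp m) (hp n))
      have h2 := hn₀ m hm n hn
      rw [dist_eq_norm, lt_div_iff₀ (by positivity)] at h2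
      rw [dist_eq_norm]
      simp only [Prod.snd_sub, Prod.fst_sub, hpu'] at h1
      nlinarith [norm_nonneg (u m - u n), le_abs_self K]
    obtain ⟨m, hm⟩ := cauchySeq_tendsto_of_complete hcau
    refine ⟨m, mem_closure_of_tendsto (f := p) (b := Filter.atTop) ?_
      (Filter.Eventually.of_forall hp)⟩
    rw [← funext hpu'] at hlim
    exact hlim.prodMk_nhds hm
  have huniq : ∀ p ∈ G.topologicalClosure, ∀ q ∈ G.topologicalClosure, p.1 = q.1 → p.2 = q.2 := by
    intro p hp q hq h
    have h1 := hbound _ (sub_mem hp hq)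
    simp only [Prod.snd_sub, Prod.fst_sub, h, sub_self, norm_zero, mul_zero] at h1
    exact sub_eq_zero.1 (norm_le_zero_iff.1 h1)
  choose f hf using hsurj
  have hspec : ∀ p ∈ G.topologicalClosure, ∀ a : A, (a : B) = p.1 → f a a.2 = p.2 :=
    fun p hp a ha => huniq _ (hf a a.2) p hp ha
  let σ : A →ₐ[ℂ] M :=
    { toFun := fun a => f a a.2
      map_one' := hspec 1 (one_mem _) 1 rfl
      map_mul' := fun a b => hspec _ (mul_mem (hf a a.2) (hf b b.2)) (a * b) rfl
      map_zero' := hspec 0 (zero_mem _) 0 rfl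
      map_add' := fun a b => hspec _ (add_mem (hf a a.2) (hf b b.2)) (a + b) rfl
      commutes' := fun c => hspec _ (G.topologicalClosure.algebraMap_mem c) _ rfl }
  refine ⟨σ, ?_, fun p hp => hspec p (subset_closure hp)⟩
  exact AddMonoidHomClass.continuous_of_bound σ K fun a => hbound _ (hf a a.2)

theorem le_of_forall_mul_pow_le {c D t u : ℝ} (hc : 0 < c) (hu : 0 ≤ u)
    (h : ∀ n : ℕ, n ≠ 0 → c * t ^ n ≤ D * u ^ n) : t ≤ u := by
  by_contra! hlt
  have ht : 0 < t := hu.trans_lt hlt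
  have hlim : Filter.Tendsto (fun n : ℕ => D * (u / t) ^ n) Filter.atTop (nhds (D * 0)) :=
    (tendsto_pow_atTop_nhds_zero_of_lt_one (by positivity) ((div_lt_one ht).2 hlt)).const_mul D
  have hle : c ≤ D * 0 := by
    refine ge_of_tendsto hlim ((Filter.eventually_ne_atTop 0).mono fun n hn => ?_)
    rw [div_pow, ← mul_div_assoc, le_div_iff₀ (by positivity)]
    exact h n hn
  linarith

open Polynomial

section Algebraic

variable {R : Type*} [Ring R] {r s : R}

theorem commute_twoProj_left (hr : r * r = r) :
    Commute (r * s * r + (1 - r) * (1 - s) * (1 - r)) r := by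
  have h : (1 - r) * r = 0 := by rw [sub_mul, one_mul, hr, sub_self]
  have h' : r * (1 - r) = 0 := by rw [mul_sub, mul_one, hr, sub_self]
  rw [Commute, SemiconjBy, add_mul, mul_add, mul_assoc _ (1 - r) r, h, mul_assoc _ r r, hr,
    ← mul_assoc r (_ * _) (1 - r), ← mul_assoc r (1 - r), h', ← mul_assoc r (r * s),
    ← mul_assoc r r, hr]
  simp

theorem twoProj_eq (hr : r * r = r) (hs : s * s = s) :
    r * s * r + (1 - r) * (1 - s) * (1 - r) = 1 - (r - s) * (r - s) := by
  have h : r * s * r + (1 - r) * (1 - s) * (1 - r) = 1 - r - r + r * r - s + r * s + s * r := by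
    noncomm_ring
  rw [h, sub_mul, mul_sub, mul_sub, hr, hs]
  abel

theorem commute_twoProj_right (hr : r * r = r) (hs : s * s = s) :
    Commute (r * s * r + (1 - r) * (1 - s) * (1 - r)) s := by
  have h : r * s * r + (1 - r) * (1 - s) * (1 - r)
      = s * r * s + (1 - s) * (1 - r) * (1 - s) := by
    rw [twoProj_eq hr hs, twoProj_eq hs hr]
    noncomm_ring
  rw [h]
  exact commute_twoProj_left hs

theorem twoProj_mul_left (hr : r * r = r) :
    (r * s * r + (1 - r) * (1 - s) * (1 - r)) * r = r * s * r := by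
  have h : (1 - r) * r = 0 := by rw [sub_mul, one_mul, hr, sub_self]
  rw [add_mul, mul_assoc _ (1 - r) r, h, mul_zero, add_zero, mul_assoc _ r r, hr]

theorem offDiag_mul_offDiag (hr : r * r = r) (hs : s * s = s) {x : R}
    (hx : x = r * s * r + (1 - r) * (1 - s) * (1 - r)) :
    (r * s * (1 - r)) * ((1 - r) * s * r) = x * (1 - x) * r := by
  have h1 : x * r = r * s * r := hx ▸ twoProj_mul_left hr
  have hc : Commute x r := hx ▸ commute_twoProj_left hr
  have hr' : (1 - r) * (1 - r) = 1 - r := by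
    rw [mul_sub, mul_one, sub_mul, one_mul, hr, sub_self, sub_zero]
  have h2 : x * (1 - x) * r = x * r - (x * r) * (x * r) := by
    rw [hc.symm.mul_mul_mul_comm, hr]; noncomm_ring
  have h3 : (r * s * (1 - r)) * ((1 - r) * s * r) = r * s * ((1 - r) * (1 - r)) * s * r := by
    noncomm_ring
  have h4 : r * s * (1 - r) * s * r = r * (s * s) * r - r * s * r * s * r := by noncomm_ring
  have h5 : (r * s * r) * (r * s * r) = r * s * (r * r) * s * r := by noncomm_ring
  rw [h2, h1, h3, hr', h4, hs, h5, hr]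

theorem offDiag_mul_offDiag' (hr : r * r = r) (hs : s * s = s) {x : R}
    (hx : x = r * s * r + (1 - r) * (1 - s) * (1 - r)) :
    ((1 - r) * s * r) * (r * s * (1 - r)) = x * (1 - x) * (1 - r) := by
  have hr' : (1 - r) * (1 - r) = 1 - r := by
    rw [mul_sub, mul_one, sub_mul, one_mul, hr, sub_self, sub_zero]
  have hs' : (1 - s) * (1 - s) = 1 - s := by
    rw [mul_sub, mul_one, sub_mul, one_mul, hs, sub_self, sub_zero]
  have hx' : x = (1 - r) * (1 - s) * (1 - r)
      + (1 - (1 - r)) * (1 - (1 - s)) * (1 - (1 - r)) := by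
    rw [hx, sub_sub_cancel, sub_sub_cancel, add_comm]
  rw [← offDiag_mul_offDiag hr' hs' hx', sub_sub_cancel]
  have h : (1 - r) * r = 0 := by rw [sub_mul, one_mul, hr, sub_self]
  have h' : r * (1 - r) = 0 := by rw [mul_sub, mul_one, hr, sub_self]
  have h1 : (1 - r) * (1 - s) * r = -((1 - r) * s * r) := by
    rw [mul_sub, mul_one, sub_mul, h, zero_sub]
  have h2 : r * (1 - s) * (1 - r) = -(r * s * (1 - r)) := by
    have h3 : r * (1 - s) * (1 - r) = r * (1 - r) - r * s * (1 - r) := by noncomm_ring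
    rw [h3, h', zero_sub]
  rw [h1, h2, neg_mul_neg]

end Algebraic

theorem Polynomial.commute_aeval {x r : B} (h : Commute x r) (p : ℂ[X]) :
    Commute (aeval x p) r := by
  induction p using Polynomial.induction_on' with
  | add p q hp hq => simpa using hp.add_left hq
  | monomial n a =>
    rw [aeval_monomial]
    exact (Algebra.commute_algebraMap_left a r).mul_left (h.pow_left n)

theorem norm_eval_le_norm_aeval_mul_of_ne [CompleteSpace B] {r s x : B} (hr : r * r = r)
    (hs : s * s = s) (hx : x = r * s * r + (1 - r) * (1 - s) * (1 - r)) {z : ℂ}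
    (hz : z ∈ spectrum ℂ x) (hz0 : z ≠ 0) (hz1 : z ≠ 1) (p : ℂ[X]) :
    ‖p.eval z‖ ≤ ‖aeval x p * r‖ := by
  have hxr : Commute x r := hx ▸ commute_twoProj_left hr
  have hxs : Commute x s := hx ▸ commute_twoProj_right hr hs
  have hc : 0 < ‖z * (1 - z)‖ := norm_pos_iff.2 (mul_ne_zero hz0 (sub_ne_zero.2 hz1.symm))
  refine le_of_forall_mul_pow_le (D := (‖x * (1 - x)‖ + ‖(1 - r) * s * r‖ * ‖r * s * (1 - r)‖)
    * ‖(1 : B)‖) hc (norm_nonneg _) fun n hn => ?_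
  set y := aeval x (p ^ n) with hy
  have hyr : Commute y r := commute_aeval hxr _
  have hys : Commute y s := commute_aeval hxs _
  have hpow : (aeval x p * r) ^ n = y * r := by
    rw [(commute_aeval hxr p).mul_pow, IsIdempotentElem.pow_eq hr hn, hy, map_pow]
  have hdecomp : x * (1 - x) * y
      = x * (1 - x) * (y * r) + (1 - r) * s * r * (y * r) * (r * s * (1 - r)) := by
    have h1 : (1 - r) * s * r * (y * r) * (r * s * (1 - r))
        = y * (((1 - r) * s * r) * (r * s * (1 - r))) := by
      have h2 : Commute y ((1 - r) * s * r) :=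
        (((Commute.one_right y).sub_right hyr).mul_right hys).mul_right hyr
      have h3 : r * (r * s * (1 - r)) = r * s * (1 - r) := by
        rw [← mul_assoc, ← mul_assoc, hr]
      rw [mul_assoc _ (y * r), mul_assoc y r, h3, ← mul_assoc, ← h2.eq, mul_assoc]
    have h4 : Commute y (x * (1 - x)) := by
      have hyx : Commute y x := commute_aeval (Commute.refl x) _
      exact hyx.mul_right ((Commute.one_right y).sub_right hyx)
    rw [h1, offDiag_mul_offDiag' hr hs hx, ← mul_assoc y, h4.eq]
    noncomm_ring
  have hmem : z * (1 - z) * p.eval z ^ n ∈ spectrum ℂ (x * (1 - x) * y) := by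
    have := spectrum.subset_polynomial_aeval x (X * (1 - X) * p ^ n) ⟨z, hz, rfl⟩
    simpa [hy] using this
  have hnorm := spectrum.norm_le_norm_mul_of_mem hmem
  rw [norm_mul, norm_pow] at hnorm
  have hyn : ‖y * r‖ ≤ ‖aeval x p * r‖ ^ n := hpow ▸ norm_pow_le' _ (Nat.pos_of_ne_zero hn)
  have hle : ‖x * (1 - x) * y‖
      ≤ (‖x * (1 - x)‖ + ‖(1 - r) * s * r‖ * ‖r * s * (1 - r)‖) * ‖y * r‖ := by
    rw [hdecomp, add_mul]
    refine (norm_add_le _ _).trans (add_le_add (norm_mul_le _ _) ?_)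
    refine (norm_mul_le _ _).trans ?_
    rw [mul_right_comm]
    gcongr
    exact norm_mul_le _ _
  calc ‖z * (1 - z)‖ * ‖p.eval z‖ ^ n ≤ ‖x * (1 - x) * y‖ * ‖(1 : B)‖ := hnorm
    _ ≤ (‖x * (1 - x)‖ + ‖(1 - r) * s * r‖ * ‖r * s * (1 - r)‖) * ‖aeval x p * r‖ ^ n
        * ‖(1 : B)‖ := by gcongr; exact hle.trans (by gcongr)
    _ = _ := by ring

/-- Evaluation at a spectral point of `x` is bounded by the norm in the corner of `r`. -/
theorem norm_eval_le_norm_aeval_mul [CompleteSpace B] {r s x : B} (hr : r * r = r)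
    (hs : s * s = s) (hx : x = r * s * r + (1 - r) * (1 - s) * (1 - r))
    (h0 : (0 : ℂ) ∈ spectrum ℂ x → AccPt (0 : ℂ) (Filter.principal (spectrum ℂ x)))
    (h1 : (1 : ℂ) ∈ spectrum ℂ x → AccPt (1 : ℂ) (Filter.principal (spectrum ℂ x))) {z : ℂ}
    (hz : z ∈ spectrum ℂ x) (p : ℂ[X]) :
    ‖p.eval z‖ ≤ ‖aeval x p * r‖ := by
  by_cases hz01 : z ≠ 0 ∧ z ≠ 1
  · exact norm_eval_le_norm_aeval_mul_of_ne hr hs hx hz hz01.1 hz01.2 p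
  have hacc : AccPt z (Filter.principal (spectrum ℂ x)) := by
    by_cases hz0 : z = 0
    · subst hz0; exact h0 hz
    · have hz1 : z = 1 := by tauto
      subst hz1; exact h1 hz
  have hopen : IsOpen (({0, 1} : Set ℂ) \ {z})ᶜ :=
    ((Set.toFinite ({0, 1} : Set ℂ)).subset Set.sdiff_subset).isClosed.isOpen_compl
  have hev : ∀ᶠ v in nhdsWithin z {z}ᶜ, v ∉ ({0, 1} : Set ℂ) := by
    filter_upwards [mem_nhdsWithin_of_mem_nhds (hopen.mem_nhds (by simp : z ∈ _)),
      self_mem_nhdsWithin] with v hv hvz hv'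
    exact hv ⟨hv', hvz⟩
  have hclosed : IsClosed {v : ℂ | ‖p.eval v‖ ≤ ‖aeval x p * r‖} :=
    isClosed_le (by fun_prop) continuous_const
  have hfreq := (accPt_iff_frequently_nhdsNE.1 hacc).and_eventually hev
  change z ∈ {v : ℂ | ‖p.eval v‖ ≤ ‖aeval x p * r‖}
  refine hclosed.mem_of_frequently_of_tendsto (f := id) (hfreq.mono ?_)
    (Filter.tendsto_id.mono_left nhdsWithin_le_nhds)
  rintro v ⟨hv, hv'⟩
  simp only [Set.mem_insert_iff, Set.mem_singleton_iff, not_or] at hv'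
  exact norm_eval_le_norm_aeval_mul_of_ne hr hs hx hv hv'.1 hv'.2 p

theorem norm_eval_le_norm_aeval_mul_compl [CompleteSpace B] {r s x : B} (hr : r * r = r)
    (hs : s * s = s) (hx : x = r * s * r + (1 - r) * (1 - s) * (1 - r))
    (h0 : (0 : ℂ) ∈ spectrum ℂ x → AccPt (0 : ℂ) (Filter.principal (spectrum ℂ x)))
    (h1 : (1 : ℂ) ∈ spectrum ℂ x → AccPt (1 : ℂ) (Filter.principal (spectrum ℂ x))) {z : ℂ}
    (hz : z ∈ spectrum ℂ x) (p : ℂ[X]) :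
    ‖p.eval z‖ ≤ ‖aeval x p * (1 - r)‖ := by
  refine norm_eval_le_norm_aeval_mul (s := 1 - s) ?_ ?_ ?_ h0 h1 hz p
  · exact IsIdempotentElem.one_sub hr
  · exact IsIdempotentElem.one_sub hs
  · rw [hx, sub_sub_cancel, sub_sub_cancel, add_comm]

/-- The matrix of `s` in the two-dimensional representation at the point `z`. -/
def twoProjMatrix (z w : ℂ) : Matrix (Fin 2) (Fin 2) ℂ := !![z, w; w, 1 - z]

/-- Elements generated by two idempotents have a Peirce normal form with polynomial
coefficients in the central element `x`. -/
theorem exists_peirce_form {r s x : B} (hr : r * r = r) (hs : s * s = s)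
    (hx : x = r * s * r + (1 - r) * (1 - s) * (1 - r)) {z w : ℂ} (hw : w ^ 2 = z * (1 - z))
    {q : B × Matrix (Fin 2) (Fin 2) ℂ}
    (hq : q ∈ Algebra.adjoin ℂ
      ({(r, !![1, 0; 0, 0]), (s, twoProjMatrix z w)} : Set (B × Matrix (Fin 2) (Fin 2) ℂ))) :
    ∃ p₁ p₂ p₃ p₄ : ℂ[X],
      q.1 = aeval x p₁ * r + aeval x p₂ * (1 - r) + aeval x p₃ * (r * s * (1 - r))
        + aeval x p₄ * ((1 - r) * s * r) ∧
      q.2 = !![p₁.eval z, w * p₃.eval z; w * p₄.eval z, p₂.eval z] := by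
  have hxr : Commute x r := hx ▸ commute_twoProj_left hr
  have hxs : Commute x s := hx ▸ commute_twoProj_right hr hs
  have hxr1 : x * r = r * s * r := hx ▸ twoProj_mul_left hr
  have hr' : (1 - r) * (1 - r) = 1 - r := IsIdempotentElem.one_sub hr
  have hrr' : r * (1 - r) = 0 := by rw [mul_sub, mul_one, hr, sub_self]
  have hr'r : (1 - r) * r = 0 := by rw [sub_mul, one_mul, hr, sub_self]
  have huv := offDiag_mul_offDiag hr hs hx
  have hvu := offDiag_mul_offDiag' hr hs hx
  induction hq using Algebra.adjoin_induction with
  | mem q hq =>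
    rcases hq with rfl | rfl
    · exact ⟨1, 0, 0, 0, by simp, by simp⟩
    · refine ⟨X, 1 - X, 1, 1, ?_, by simp [twoProjMatrix]⟩
      have hxr1' : (1 - x) * (1 - r) = (1 - r) * s * (1 - r) := by
        have h2 : (1 - x) * (1 - r) = 1 - x - r + x * r := by noncomm_ring
        rw [h2, hxr1, hx]
        have h3 : (1 - r) * (1 - s) * (1 - r) = (1 - r) * (1 - r) - (1 - r) * s * (1 - r) := by
          noncomm_ring
        rw [h3, hr']
        abel
      simp only [aeval_X, map_sub, map_one, one_mul, hxr1, hxr1']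
      noncomm_ring
  | algebraMap c =>
    refine ⟨C c, C c, 0, 0, ?_, ?_⟩
    · simp [← mul_add]
    · ext i j
      fin_cases i <;> fin_cases j <;> simp [Matrix.algebraMap_matrix_apply]
  | add a b _ _ ha hb =>
    obtain ⟨p₁, p₂, p₃, p₄, ha₁, ha₂⟩ := ha
    obtain ⟨q₁, q₂, q₃, q₄, hb₁, hb₂⟩ := hb
    refine ⟨p₁ + q₁, p₂ + q₂, p₃ + q₃, p₄ + q₄, ?_, ?_⟩
    · simp only [Prod.fst_add, ha₁, hb₁, map_add, add_mul]
      abel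
    · simp [ha₂, hb₂, mul_add]
  | mul a b _ _ ha hb =>
    obtain ⟨p₁, p₂, p₃, p₄, ha₁, ha₂⟩ := ha
    obtain ⟨q₁, q₂, q₃, q₄, hb₁, hb₂⟩ := hb
    refine ⟨p₁ * q₁ + X * (1 - X) * p₃ * q₄, p₂ * q₂ + X * (1 - X) * p₄ * q₃,
      p₁ * q₃ + p₃ * q₂, p₄ * q₁ + p₂ * q₄, ?_, ?_⟩
    · have hcr : ∀ p : ℂ[X], Commute r (aeval x p) := fun p => (commute_aeval hxr p).symm
      have hcs : ∀ p : ℂ[X], Commute s (aeval x p) := fun p => (commute_aeval hxs p).symm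
      have hcr' : ∀ p : ℂ[X], Commute (1 - r) (aeval x p) := fun p =>
        (Commute.one_left _).sub_left (hcr p)
      have hcu : ∀ p : ℂ[X], Commute (r * s * (1 - r)) (aeval x p) := fun p =>
        ((hcr p).mul_left (hcs p)).mul_left (hcr' p)
      have hcv : ∀ p : ℂ[X], Commute ((1 - r) * s * r) (aeval x p) := fun p =>
        ((hcr' p).mul_left (hcs p)).mul_left (hcr p)
      have hru : r * (r * s * (1 - r)) = r * s * (1 - r) := by rw [← mul_assoc, ← mul_assoc, hr]
      have hur : (r * s * (1 - r)) * r = 0 := by rw [mul_assoc, hr'r, mul_zero]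
      have hur' : (r * s * (1 - r)) * (1 - r) = r * s * (1 - r) := by rw [mul_assoc, hr']
      have hr'u : (1 - r) * (r * s * (1 - r)) = 0 := by
        rw [← mul_assoc, ← mul_assoc, hr'r, zero_mul, zero_mul]
      have hrv : r * ((1 - r) * s * r) = 0 := by
        rw [← mul_assoc, ← mul_assoc, hrr', zero_mul, zero_mul]
      have hvr : ((1 - r) * s * r) * r = (1 - r) * s * r := by rw [mul_assoc, hr]
      have hvr' : ((1 - r) * s * r) * (1 - r) = 0 := by rw [mul_assoc, hrr', mul_zero]
      have hr'v : (1 - r) * ((1 - r) * s * r) = (1 - r) * s * r := by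
        rw [← mul_assoc, ← mul_assoc, hr']
      have huu : (r * s * (1 - r)) * (r * s * (1 - r)) = 0 := by
        rw [mul_assoc _ (1 - r), hr'u, mul_zero]
      have hvv : ((1 - r) * s * r) * ((1 - r) * s * r) = 0 := by
        rw [mul_assoc _ r, hrv, mul_zero]
      have hX : x * (1 - x) = aeval x (X * (1 - X) : ℂ[X]) := by simp
      rw [hX] at huv hvu
      rw [Prod.fst_mul, ha₁, hb₁]
      generalize r * s * (1 - r) = u at *
      generalize (1 - r) * s * r = v at *
      generalize 1 - r = r' at *
      simp only [mul_add, add_mul, (hcr _).mul_mul_mul_comm, (hcr' _).mul_mul_mul_comm,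
        (hcu _).mul_mul_mul_comm, (hcv _).mul_mul_mul_comm, hr, hrr', hru, hrv, hr'r, hr', hr'u,
        hr'v, hur, hur', huu, huv, hvr, hvr', hvu, hvv, mul_zero, add_zero, zero_add]
      rw [show X * (1 - X) * p₃ * q₄ = p₃ * q₄ * (X * (1 - X)) by ring,
        show X * (1 - X) * p₄ * q₃ = p₄ * q₃ * (X * (1 - X)) by ring]
      simp only [map_add, map_mul, add_mul, mul_assoc]
      abel
    · rw [Prod.snd_mul, ha₂, hb₂]
      ext i j
      fin_cases i <;> fin_cases j <;> simp [Matrix.mul_apply, Fin.sum_univ_two]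
      · linear_combination p₃.eval z * q₄.eval z * hw
      · ring
      · ring
      · linear_combination p₄.eval z * q₃.eval z * hw

theorem exists_norm_apply_le [CompleteSpace B] {r s x : B} (hr : r * r = r) (hs : s * s = s)
    (hx : x = r * s * r + (1 - r) * (1 - s) * (1 - r))
    (h0 : (0 : ℂ) ∈ spectrum ℂ x → AccPt (0 : ℂ) (Filter.principal (spectrum ℂ x)))
    (h1 : (1 : ℂ) ∈ spectrum ℂ x → AccPt (1 : ℂ) (Filter.principal (spectrum ℂ x))) {z w : ℂ}
    (hz : z ∈ spectrum ℂ x) (hw : w ^ 2 = z * (1 - z)) (a b : Fin 2) :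
    ∃ K : ℝ, 0 ≤ K ∧ ∀ q ∈ Algebra.adjoin ℂ
      ({(r, !![1, 0; 0, 0]), (s, twoProjMatrix z w)} : Set (B × Matrix (Fin 2) (Fin 2) ℂ)),
      ‖q.2 a b‖ ≤ K * ‖q.1‖ := by
  set H := Algebra.adjoin ℂ
    ({(r, !![1, 0; 0, 0]), (s, twoProjMatrix z w)} : Set (B × Matrix (Fin 2) (Fin 2) ℂ))
  have hr' : (1 - r) * (1 - r) = 1 - r := IsIdempotentElem.one_sub hr
  have hrr' : r * (1 - r) = 0 := by rw [mul_sub, mul_one, hr, sub_self]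
  have hr'r : (1 - r) * r = 0 := by rw [sub_mul, one_mul, hr, sub_self]
  have hxr : Commute x r := hx ▸ commute_twoProj_left hr
  have hcr : ∀ p : ℂ[X], Commute r (aeval x p) := fun p => (commute_aeval hxr p).symm
  have hcr' : ∀ p : ℂ[X], Commute (1 - r) (aeval x p) := fun p =>
    (Commute.one_left _).sub_left (hcr p)
  have h00 : ∀ q ∈ H, ‖q.2 0 0‖ ≤ ‖r‖ * ‖r‖ * ‖q.1‖ := by
    intro q hq
    obtain ⟨p₁, p₂, p₃, p₄, hq₁, hq₂⟩ := exists_peirce_form hr hs hx hw hq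
    have hcorner : r * q.1 * r = aeval x p₁ * r := by
      rw [hq₁]
      simp only [mul_add, add_mul, ← mul_assoc, (hcr _).eq]
      simp only [mul_assoc, hr, hrr', hr'r, mul_zero, add_zero]
      simp only [zero_mul, add_zero]
    calc ‖q.2 0 0‖ = ‖p₁.eval z‖ := by simp [hq₂]
      _ ≤ ‖r * q.1 * r‖ := hcorner ▸ norm_eval_le_norm_aeval_mul hr hs hx h0 h1 hz p₁
      _ ≤ ‖r‖ * ‖q.1‖ * ‖r‖ := norm_mul₃_le
      _ = _ := by ring
  have h11 : ∀ q ∈ H, ‖q.2 1 1‖ ≤ ‖1 - r‖ * ‖1 - r‖ * ‖q.1‖ := by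
    intro q hq
    obtain ⟨p₁, p₂, p₃, p₄, hq₁, hq₂⟩ := exists_peirce_form hr hs hx hw hq
    have hcorner : (1 - r) * q.1 * (1 - r) = aeval x p₂ * (1 - r) := by
      rw [hq₁]
      generalize 1 - r = r' at *
      simp only [mul_add, add_mul, ← mul_assoc, (hcr' _).eq]
      simp only [mul_assoc, hr', hrr', hr'r, mul_zero, add_zero]
      simp only [zero_mul, zero_add, add_zero]
    calc ‖q.2 1 1‖ = ‖p₂.eval z‖ := by simp [hq₂]
      _ ≤ ‖(1 - r) * q.1 * (1 - r)‖ :=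
        hcorner ▸ norm_eval_le_norm_aeval_mul_compl hr hs hx h0 h1 hz p₂
      _ ≤ ‖1 - r‖ * ‖q.1‖ * ‖1 - r‖ := norm_mul₃_le
      _ = _ := by ring
  have hrH : (r, !![1, 0; 0, 0]) ∈ H := Algebra.subset_adjoin (by simp)
  have hsH : (s, twoProjMatrix z w) ∈ H := Algebra.subset_adjoin (by simp)
  have hr'H := sub_mem (one_mem H) hrH
  have hoff : ∀ q ∈ H, w = 0 → q.2 0 1 = 0 ∧ q.2 1 0 = 0 := by
    intro q hq hw0
    obtain ⟨p₁, p₂, p₃, p₄, -, hq₂⟩ := exists_peirce_form hr hs hx hw hq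
    simp [hq₂, hw0]
  have h01 : ∀ q ∈ H, ‖q.2 0 1‖ ≤ ‖r‖ * ‖r‖ * ‖(1 - r) * s‖ / ‖w‖ * ‖q.1‖ := by
    intro q hq
    by_cases hw0 : w = 0
    · simp [hoff q hq hw0, hw0]
    have h := h00 _ (mul_mem hq (mul_mem hr'H hsH))
    have hent : (q * ((1 - (r, !![1, 0; 0, 0])) * (s, twoProjMatrix z w))).2 0 0
        = q.2 0 1 * w := by
      simp [Matrix.mul_apply, Fin.sum_univ_two, twoProjMatrix]
    rw [hent, norm_mul] at h
    rw [div_mul_eq_mul_div, le_div_iff₀ (norm_pos_iff.2 hw0)]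
    calc _ ≤ _ := h
      _ ≤ ‖r‖ * ‖r‖ * (‖q.1‖ * ‖(1 - r) * s‖) := by gcongr; exact norm_mul_le _ _
      _ = _ := by ring
  have h10 : ∀ q ∈ H, ‖q.2 1 0‖ ≤ ‖r‖ * ‖r‖ * (‖s‖ * ‖1 - r‖) / ‖w‖ * ‖q.1‖ := by
    intro q hq
    by_cases hw0 : w = 0
    · simp [hoff q hq hw0, hw0]
    have h := h00 _ (mul_mem hsH (mul_mem hr'H hq))
    have hent : ((s, twoProjMatrix z w) * ((1 - (r, !![1, 0; 0, 0])) * q)).2 0 0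
        = w * q.2 1 0 := by
      simp [Matrix.mul_apply, Fin.sum_univ_two, twoProjMatrix]
    rw [hent, norm_mul] at h
    rw [div_mul_eq_mul_div, le_div_iff₀ (norm_pos_iff.2 hw0)]
    calc _ = ‖w‖ * ‖q.2 1 0‖ := mul_comm _ _
      _ ≤ _ := h
      _ ≤ ‖r‖ * ‖r‖ * (‖s‖ * (‖1 - r‖ * ‖q.1‖)) := by
        gcongr
        exact (norm_mul_le _ _).trans (by gcongr; exact norm_mul_le _ _)
      _ = _ := by ring
  fin_cases a <;> fin_cases b
  exacts [⟨_, by positivity, h00⟩, ⟨_, by positivity, h01⟩, ⟨_, by positivity, h10⟩,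
    ⟨_, by positivity, h11⟩]

theorem Subalgebra.exists_continuous_algHom_of_graph_matrix {n : Type*} [Fintype n] [DecidableEq n]
    (G : Subalgebra ℂ (B × Matrix n n ℂ))
    (hG : ∀ i j, ∃ K : ℝ, ∀ p ∈ G, ‖p.2 i j‖ ≤ K * ‖p.1‖) :
    ∃ σ : (G.map (AlgHom.fst ℂ B (Matrix n n ℂ))).topologicalClosure →ₐ[ℂ] Matrix n n ℂ,
      Continuous σ ∧ ∀ p ∈ G,
        ∀ a : (G.map (AlgHom.fst ℂ B (Matrix n n ℂ))).topologicalClosure,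
        (a : B) = p.1 → σ a = p.2 := by
  let : NormedRing (Matrix n n ℂ) := Matrix.linftyOpNormedRing
  let : NormedAlgebra ℂ (Matrix n n ℂ) := Matrix.linftyOpNormedAlgebra
  choose K hK using hG
  refine G.exists_continuous_algHom_of_graph
    (∑ i, ∑ j, K i j * ‖(Matrix.single i j 1 : Matrix n n ℂ)‖) fun p hp => ?_
  rw [Finset.sum_mul]
  conv_lhs => rw [Matrix.matrix_eq_sum_single p.2]
  refine (norm_sum_le _ _).trans (Finset.sum_le_sum fun i _ => ?_)
  rw [Finset.sum_mul]
  refine (norm_sum_le _ _).trans (Finset.sum_le_sum fun j _ => ?_)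
  have hsmul : Matrix.single i j (p.2 i j) = p.2 i j • (Matrix.single i j 1 : Matrix n n ℂ) := by
    simp
  rw [hsmul, mul_right_comm]
  exact (norm_smul_le _ _).trans (mul_le_mul_of_nonneg_right (hK i j p hp) (norm_nonneg _))

/-- The coefficient of `b` at position `(i, j)` with respect to a system `e` of matrix units. -/
def matrixUnitCoeff {R : Type*} [Ring R] {N : ℕ} (e : Fin N → Fin N → R)
    (i j : Fin N) (b : R) : R :=
  ∑ k, e k i * b * e j k

/-- The `2 × 2` matrix formed by the `(i, j)` entries of the four blocks of `m`. -/
def blockEntries {N : ℕ} (m : Matrix (Fin N ⊕ Fin N) (Fin N ⊕ Fin N) ℂ) (i j : Fin N) :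
    Matrix (Fin 2) (Fin 2) ℂ :=
  !![m (.inl i) (.inl j), m (.inl i) (.inr j); m (.inr i) (.inl j), m (.inr i) (.inr j)]

theorem blockEntries_mul {N : ℕ} (m m' : Matrix (Fin N ⊕ Fin N) (Fin N ⊕ Fin N) ℂ)
    (i j : Fin N) : blockEntries (m * m') i j = ∑ l, blockEntries m i l * blockEntries m' l j := by
  ext a b
  simp only [Matrix.sum_apply, Matrix.mul_apply, Fin.sum_univ_two]
  fin_cases a <;> fin_cases b <;>
    simp [blockEntries, Matrix.mul_apply, Finset.sum_add_distrib]

theorem matrixUnitCoeff_mul {R : Type*} [Ring R] {N : ℕ} {e : Fin N → Fin N → R}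
    (he : ∀ i j k l, e i j * e k l = if j = k then e i l else 0) (hsum : ∑ i, e i i = 1)
    (i j : Fin N) (a b : R) : matrixUnitCoeff e i j (a * b)
      = ∑ l, matrixUnitCoeff e i l a * matrixUnitCoeff e l j b := by
  have hterm : ∀ l, matrixUnitCoeff e i l a * matrixUnitCoeff e l j b
      = ∑ k, e k i * a * e l l * b * e j k := by
    intro l
    rw [matrixUnitCoeff, matrixUnitCoeff, Finset.sum_mul_sum]
    refine Finset.sum_congr rfl fun k _ => ?_
    have h : ∀ k', e k i * a * e l k * (e k' l * b * e j k')
        = e k i * a * (e l k * e k' l) * b * e j k' := fun k' => by noncomm_ring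
    simp only [h, he, mul_ite, ite_mul, mul_zero, zero_mul, Finset.sum_ite_eq, Finset.mem_univ,
      if_true]
  rw [Finset.sum_congr rfl fun l _ => hterm l, Finset.sum_comm, matrixUnitCoeff]
  refine Finset.sum_congr rfl fun k _ => ?_
  simp only [← Finset.sum_mul, ← Finset.mul_sum, hsum, one_mul, mul_assoc]

theorem matrixUnitCoeff_of_commute {R : Type*} [Ring R] {N : ℕ} {e : Fin N → Fin N → R}
    (he : ∀ i j k l, e i j * e k l = if j = k then e i l else 0) (hsum : ∑ i, e i i = 1)
    (i j : Fin N) {b : R} (hb : ∀ i j, e i j * b = b * e i j) :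
    matrixUnitCoeff e i j b = if i = j then b else 0 := by
  simp only [matrixUnitCoeff, hb, mul_assoc, he]
  split_ifs with h
  · rw [← Finset.mul_sum, hsum, mul_one]
  · simp

theorem norm_matrixUnitCoeff_le {R : Type*} [NormedRing R] {N : ℕ} (e : Fin N → Fin N → R)
    (i j : Fin N) (b : R) :
    ‖matrixUnitCoeff e i j b‖ ≤ (∑ k, ‖e k i‖ * ‖e j k‖) * ‖b‖ := by
  rw [Finset.sum_mul]
  refine (norm_sum_le _ _).trans (Finset.sum_le_sum fun k _ => norm_mul₃_le.trans_eq ?_)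
  ring

/-- The matrix coefficients of an element of the algebra generated by matrix units and two commuting
idempotents, paired with those of its block matrix, lie in the algebra generated by the
idempotents, paired with their `2 × 2` matrices. -/
theorem matrixUnitCoeff_blockEntries_mem {N : ℕ} {r s : B} (φ : Matrix (Fin N) (Fin N) ℂ →ₐ[ℂ] B)
    (hr : ∀ c, φ c * r = r * φ c) (hs : ∀ c, φ c * s = s * φ c) (z w : ℂ)
    {q : B × Matrix (Fin N ⊕ Fin N) (Fin N ⊕ Fin N) ℂ}
    (hq : q ∈ Algebra.adjoin ℂ (Set.range (fun c => (φ c, Matrix.fromBlocks c 0 0 c)) ∪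
      {(r, Matrix.fromBlocks 1 0 0 0),
        (s, Matrix.fromBlocks (z • 1) (w • 1) (w • 1) ((1 - z) • 1))})) (i j : Fin N) :
    (matrixUnitCoeff (fun k l => φ (Matrix.single k l 1)) i j q.1, blockEntries q.2 i j) ∈
      Algebra.adjoin ℂ
        ({(r, !![1, 0; 0, 0]), (s, twoProjMatrix z w)} : Set (B × Matrix (Fin 2) (Fin 2) ℂ)) := by
  set e : Fin N → Fin N → B := fun k l => φ (Matrix.single k l 1) with he_def
  set H := Algebra.adjoin ℂ
    ({(r, !![1, 0; 0, 0]), (s, twoProjMatrix z w)} : Set (B × Matrix (Fin 2) (Fin 2) ℂ))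
  have he : ∀ i j k l, e i j * e k l = if j = k then e i l else 0 := by
    intro i j k l
    rw [he_def, ← map_mul]
    split_ifs with h
    · simp [h]
    · simp [h]
  have hdiag : ∀ a : ℂ, ∑ k : Fin N, Matrix.single k k a = a • (1 : Matrix (Fin N) (Fin N) ℂ) := by
    intro a
    rw [Matrix.sum_single_eq_diagonal, Matrix.smul_one_eq_diagonal]
  have hsum : ∑ i, e i i = 1 := by
    rw [he_def, ← map_sum, hdiag, one_smul, map_one]
  have hrH : (r, !![1, 0; 0, 0]) ∈ H := Algebra.subset_adjoin (by simp)
  have hsH : (s, twoProjMatrix z w) ∈ H := Algebra.subset_adjoin (by simp)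
  have hscalar : ∀ (c : Matrix (Fin N) (Fin N) ℂ) (i j : Fin N),
      (matrixUnitCoeff e i j (φ c), blockEntries (Matrix.fromBlocks c 0 0 c) i j) ∈ H := by
    intro c i j
    have h : matrixUnitCoeff e i j (φ c) = algebraMap ℂ B (c i j) := by
      simp only [matrixUnitCoeff, he_def, ← map_mul, ← map_sum, Matrix.single_mul_mul_single,
        one_mul, mul_one, hdiag, map_smul, map_one, Algebra.algebraMap_eq_smul_one]
    have h' : blockEntries (Matrix.fromBlocks c 0 0 c) i j
        = algebraMap ℂ (Matrix (Fin 2) (Fin 2) ℂ) (c i j) := by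
      ext a b
      fin_cases a <;> fin_cases b <;> simp [blockEntries, Matrix.algebraMap_matrix_apply]
    rw [h, h']
    exact H.algebraMap_mem (c i j)
  have hgen : ∀ (b : B) (M : Matrix (Fin 2) (Fin 2) ℂ)
      (m : Matrix (Fin N ⊕ Fin N) (Fin N ⊕ Fin N) ℂ), (∀ c, φ c * b = b * φ c) →
      (∀ i j, blockEntries m i j = if i = j then M else 0) → (b, M) ∈ H →
      ∀ i j, (matrixUnitCoeff e i j b, blockEntries m i j) ∈ H := by
    intro b M m hb hm hbM i j
    rw [matrixUnitCoeff_of_commute he hsum i j fun _ _ => hb _, hm]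
    split_ifs
    · exact hbM
    · exact zero_mem H
  induction hq using Algebra.adjoin_induction generalizing i j with
  | mem q hq =>
    rcases hq with ⟨c, rfl⟩ | rfl | rfl
    · exact hscalar c i j
    · refine hgen r _ _ hr (fun i j => ?_) hrH i j
      split_ifs with h <;> ext a b <;> fin_cases a <;> fin_cases b <;> simp [blockEntries, h]
    · refine hgen s _ _ hs (fun i j => ?_) hsH i j
      split_ifs with h <;> ext a b <;> fin_cases a <;> fin_cases b <;>
        simp [blockEntries, twoProjMatrix, h]
  | algebraMap c =>
    have h : algebraMap ℂ (B × Matrix (Fin N ⊕ Fin N) (Fin N ⊕ Fin N) ℂ) c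
        = (φ (c • 1), Matrix.fromBlocks (c • 1) 0 0 (c • 1)) := by
      ext : 1
      · simp [Algebra.algebraMap_eq_smul_one]
      · have := Matrix.fromBlocks_smul c (1 : Matrix (Fin N) (Fin N) ℂ) 0 0
          (1 : Matrix (Fin N) (Fin N) ℂ)
        simpa [Algebra.algebraMap_eq_smul_one] using this
    rw [h]
    exact hscalar _ i j
  | add a b _ _ ha hb =>
    have h : matrixUnitCoeff e i j (a + b).1
        = matrixUnitCoeff e i j a.1 + matrixUnitCoeff e i j b.1 := by
      simp [matrixUnitCoeff, mul_add, add_mul, Finset.sum_add_distrib]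
    have h' : blockEntries (a + b).2 i j = blockEntries a.2 i j + blockEntries b.2 i j := by
      simp [blockEntries]
    rw [h, h']
    exact add_mem (ha i j) (hb i j)
  | mul a b _ _ ha hb =>
    rw [Prod.fst_mul, Prod.snd_mul, matrixUnitCoeff_mul he hsum, blockEntries_mul]
    have h := sum_mem (S := H) (t := Finset.univ) fun l _ => mul_mem (ha i l) (hb l j)
    convert h using 1
    exact Prod.ext (by simp [Prod.fst_sum]) (by simp [Prod.snd_sum])

end Auxiliary

open Filter in
/-- **Two projections theorem, part (a).** Let `B` be a complex unital Banach algebra,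
`𝒞` a closed unital subalgebra of `B` isomorphic (as a unital `ℂ`-algebra, via `θ`) to the
algebra of `N × N` complex matrices, and let `r, s ∈ B` be idempotents commuting with every
element of `𝒞`. Let `A` be the smallest closed subalgebra of `B` containing `𝒞`, `r` and `s`,
and let `x := r s r + (e - r)(e - s)(e - r)`. Assume `0` and `1` are not isolated points of the
spectrum of `x` in `B`. Then for every `z` in the spectrum of `x` in `B` and every `w : ℂ` with
`w² = z(1 - z)` there is a continuous unital algebra homomorphism `σ : A → ℂ^{2N×2N}` with
`σ(θ c) = [[c, 0], [0, c]]`, `σ(r) = [[E, 0], [0, 0]]` and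
`σ(s) = [[zE, wE], [wE, (1-z)E]]`. -/
theorem two_projections_theorem_a
    {B : Type*} [NormedRing B] [NormedAlgebra ℂ B] [CompleteSpace B]
    (N : ℕ) (hN : 0 < N)
    (𝒞 : Subalgebra ℂ B) (h𝒞closed : IsClosed (𝒞 : Set B))
    (θ : Matrix (Fin N) (Fin N) ℂ ≃ₐ[ℂ] 𝒞)
    (r s : B) (hr : r ^ 2 = r) (hs : s ^ 2 = s)
    (hrc : ∀ c ∈ 𝒞, c * r = r * c) (hsc : ∀ c ∈ 𝒞, c * s = s * c)
    (A : Subalgebra ℂ B)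
    (hA : A = (Algebra.adjoin ℂ ((𝒞 : Set B) ∪ {r, s})).topologicalClosure)
    (x : B) (hx : x = r * s * r + (1 - r) * (1 - s) * (1 - r))
    (h0 : (0 : ℂ) ∈ spectrum ℂ x → AccPt (0 : ℂ) (𝓟 (spectrum ℂ x)))
    (h1 : (1 : ℂ) ∈ spectrum ℂ x → AccPt (1 : ℂ) (𝓟 (spectrum ℂ x)))
    (z : ℂ) (hz : z ∈ spectrum ℂ x) (w : ℂ) (hw : w ^ 2 = z * (1 - z)) :
    ∃ σ : A →ₐ[ℂ] Matrix (Fin N ⊕ Fin N) (Fin N ⊕ Fin N) ℂ,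
      Continuous σ ∧
      (∀ c : Matrix (Fin N) (Fin N) ℂ, ∀ a : A, (a : B) = (θ c : B) →
        σ a = Matrix.fromBlocks c 0 0 c) ∧
      (∀ a : A, (a : B) = r → σ a = Matrix.fromBlocks 1 0 0 0) ∧
      (∀ a : A, (a : B) = s →
        σ a = Matrix.fromBlocks (z • 1) (w • 1) (w • 1) ((1 - z) • 1)) := by
  set φ : Matrix (Fin N) (Fin N) ℂ →ₐ[ℂ] B := 𝒞.val.comp θ.toAlgHom
  have hφθ : ∀ c, φ c = (θ c : B) := fun c => rfl
  have hr' : r * r = r := by rw [← sq, hr]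
  have hs' : s * s = s := by rw [← sq, hs]
  set G : Subalgebra ℂ (B × Matrix (Fin N ⊕ Fin N) (Fin N ⊕ Fin N) ℂ) :=
    Algebra.adjoin ℂ (Set.range (fun c => (φ c, Matrix.fromBlocks c 0 0 c)) ∪
      {(r, Matrix.fromBlocks 1 0 0 0),
        (s, Matrix.fromBlocks (z • 1) (w • 1) (w • 1) ((1 - z) • 1))}) with hG
  have hblock : ∀ (i j : Fin N) (a b : Fin 2), ∃ K : ℝ, ∀ p ∈ G,
      ‖blockEntries p.2 i j a b‖ ≤ K * ‖p.1‖ := by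
    intro i j a b
    obtain ⟨K, hK0, hK⟩ := exists_norm_apply_le hr' hs' hx h0 h1 hz hw a b
    refine ⟨K * ∑ k, ‖φ (Matrix.single k i 1)‖ * ‖φ (Matrix.single j k 1)‖, fun p hp => ?_⟩
    rw [mul_assoc]
    refine (hK _ (matrixUnitCoeff_blockEntries_mem φ (fun c => hrc _ (θ c).2)
      (fun c => hsc _ (θ c).2) z w hp i j)).trans ?_
    gcongr
    exact norm_matrixUnitCoeff_le (fun k l => φ (Matrix.single k l 1)) i j p.1
  have hbound : ∀ i j, ∃ K : ℝ, ∀ p ∈ G, ‖p.2 i j‖ ≤ K * ‖p.1‖ := by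
    rintro (i | i) (j | j)
    exacts [hblock i j 0 0, hblock i j 0 1, hblock i j 1 0, hblock i j 1 1]
  have hmap : G.map (AlgHom.fst ℂ B _) = Algebra.adjoin ℂ ((𝒞 : Set B) ∪ {r, s}) := by
    have hrange : Set.range (fun c => φ c) = (𝒞 : Set B) := by
      ext b
      constructor
      · rintro ⟨c, rfl⟩
        exact (θ c).2
      · intro hb
        exact ⟨θ.symm ⟨b, hb⟩, by simp [hφθ]⟩
    rw [hG, AlgHom.map_adjoin, Set.image_union, Set.image_pair, ← Set.range_comp, ← hrange]
    rfl
  obtain rfl : A = (G.map (AlgHom.fst ℂ B _)).topologicalClosure := by rw [hA, hmap]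
  obtain ⟨σ, hσ, hσG⟩ := G.exists_continuous_algHom_of_graph_matrix hbound
  exact ⟨σ, hσ, fun c => hσG (φ c, _) (Algebra.subset_adjoin (Or.inl ⟨c, rfl⟩)),
    hσG (r, _) (Algebra.subset_adjoin (Or.inr (Or.inl rfl))),
    hσG (s, _) (Algebra.subset_adjoin (Or.inr (Or.inr rfl)))⟩
end

section
/- Two projections theorem, part (b): Suppose that for each z in the spectrum sp_B x of x in B, σ_z : A → ℂ^{2N×2N} is a continuous unital algebra homomorphism satisfying σ_z(θ(c)) = [[c, O],[O, c]] for all c ∈ ℂ^{N×N}, σ_z(r) = [[E, O],[O, O]], and σ_z(s) = [[zE, w_zE],[w_zE, (1−z)E]] for some complex number w_z with w_z² = z(1−z). Then an element a ∈ A is invertible in B if and only if det σ_z(a) ≠ 0 for all z ∈ sp_B x. -/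
open Filter Topology

/-- `A` is topologically generated by a copy of the matrix algebra and two idempotents which
commute with it. -/
structure IsTwoIdempotentAlgebra {n A : Type*} [Fintype n] [DecidableEq n] [Ring A] [Algebra ℂ A]
    [TopologicalSpace A] (θ : Matrix n n ℂ →ₐ[ℂ] A) (r s : A) : Prop where
  r_idem : r * r = r
  s_idem : s * s = s
  comm_r : ∀ c, θ c * r = r * θ c
  comm_s : ∀ c, θ c * s = s * θ c
  mem_of_isClosed : ∀ S : Subalgebra ℂ A, IsClosed (S : Set A) → (∀ c, θ c ∈ S) → r ∈ S → s ∈ S →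
    ∀ a, a ∈ S

/-- `σ` is the symbol map of a two idempotents algebra at the point `z`. -/
structure IsSymbol {n A : Type*} [Fintype n] [DecidableEq n] [Ring A] [Algebra ℂ A]
    [TopologicalSpace A] (θ : Matrix n n ℂ →ₐ[ℂ] A) (r s : A) (z w : ℂ)
    (σ : A →ₐ[ℂ] Matrix (n ⊕ n) (n ⊕ n) ℂ) : Prop where
  continuous : Continuous σ
  w_sq : w * w = z * (1 - z)
  map_θ : ∀ c, σ (θ c) = Matrix.fromBlocks c 0 0 c
  map_r : σ r = Matrix.fromBlocks 1 0 0 0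
  map_s : σ s = Matrix.fromBlocks (z • 1) (w • 1) (w • 1) ((1 - z) • 1)

section SymbolPair

variable {B : Type*} [Ring B] [Algebra ℂ B]

/-- A pair on which the idempotents `R` and `S` act modulo `K` as the symbol at `z`. -/
structure IsSymbolPair (R S : B) (z w : ℂ) (K : Submodule ℂ B) (b₁ b₂ : B) : Prop where
  fst_r : b₁ * R - b₁ ∈ K
  snd_r : b₂ * R ∈ K
  fst_s : b₁ * S - (z • b₁ + w • b₂) ∈ K
  snd_s : b₂ * S - (w • b₁ + (1 - z) • b₂) ∈ K

variable {R S x : B} {z w : ℂ} {K : Submodule ℂ B}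

theorem isSymbolPair_corner (hR : R * R = R) (hS : S * S = S)
    (hx : x = 1 - R - S + R * S + S * R) (hw : w * w = z * (1 - z))
    (hK : ∀ b, b * (x - z • 1) ∈ K) :
    IsSymbolPair R S z w K (w • R) (R * S * (1 - R)) := by
  subst hx
  have hR' (t : B) : R * (R * t) = R * t := by rw [← mul_assoc, hR]
  have hS' (t : B) : S * (S * t) = S * t := by rw [← mul_assoc, hS]
  refine ⟨?_, ?_, ?_, ?_⟩
  · simp [hR]
  · simp [mul_assoc, sub_mul, hR]
  · convert hK (w • R) using 1
    simp only [mul_sub, mul_add, mul_one, smul_mul_assoc, mul_smul_comm, mul_assoc, hR, hR']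
    module
  · convert hK ((1 - z) • R - R * S) using 1
    simp only [mul_sub, sub_mul, mul_add, mul_one, smul_mul_assoc, mul_smul_comm, mul_assoc,
      hR, hS, hR', hS']
    linear_combination (norm := module) (-hw) • R

theorem isSymbolPair_corner' (hR : R * R = R) (hS : S * S = S)
    (hx : x = 1 - R - S + R * S + S * R) (hw : w * w = z * (1 - z))
    (hK : ∀ b, b * (x - z • 1) ∈ K) :
    IsSymbolPair R S z w K ((1 - R) * S * R) (w • (1 - R)) := by
  subst hx
  have hR' (t : B) : R * (R * t) = R * t := by rw [← mul_assoc, hR]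
  have hS' (t : B) : S * (S * t) = S * t := by rw [← mul_assoc, hS]
  refine ⟨?_, ?_, ?_, ?_⟩
  · simp [mul_assoc, hR]
  · simp [sub_mul, hR]
  · convert hK ((1 - R) * S - z • (1 - R)) using 1
    simp only [mul_sub, sub_mul, mul_add, mul_one, one_mul, smul_mul_assoc, mul_smul_comm,
      mul_assoc, hR, hS, hR', hS', smul_sub]
    linear_combination (norm := module) (-hw) • (1 - R)
  · convert hK ((-w) • (1 - R)) using 1
    simp only [mul_sub, sub_mul, mul_add, mul_one, one_mul, smul_mul_assoc, mul_smul_comm,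
      mul_assoc, hR, hR', smul_sub]
    module

theorem isSymbolPair_of_degenerate (hR : R * R = R)
    (hx : x = 1 - R - S + R * S + S * R)
    (hK : ∀ b, b * (x - z • 1) ∈ K) (h₁ : R * S * (1 - R) ∈ K) (h₂ : (1 - R) * S * R ∈ K) :
    IsSymbolPair R S z 0 K R (1 - R) := by
  subst hx
  have hR' (t : B) : R * (R * t) = R * t := by rw [← mul_assoc, hR]
  refine ⟨?_, ?_, ?_, ?_⟩
  · simp [hR]
  · simp [sub_mul, hR]
  · convert K.add_mem (hK R) h₁ using 1
    simp only [mul_sub, mul_add, mul_one, mul_smul_comm, mul_assoc, hR, hR']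
    module
  · convert K.sub_mem h₂ (hK (1 - R)) using 1
    simp only [mul_sub, sub_mul, mul_add, mul_one, one_mul, mul_smul_comm, mul_assoc, hR, hR']
    module

end SymbolPair

section Intertwining

variable {n A B : Type*} [Fintype n] [DecidableEq n] [Ring A] [Algebra ℂ A]
  [NormedRing B] [NormedAlgebra ℂ B] {θ : Matrix n n ℂ →ₐ[ℂ] A} {r s : A}
  {ι : A →ₐ[ℂ] B} {z w : ℂ} {σ : A →ₐ[ℂ] Matrix (n ⊕ n) (n ⊕ n) ℂ}

/-- The vector of elements of `B` spanned by `b₁` and `b₂` and the row `i₀` of matrix units. -/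
def rowVec (θ : Matrix n n ℂ →ₐ[ℂ] A) (ι : A →ₐ[ℂ] B) (b₁ b₂ : B) (i₀ : n) : n ⊕ n → B :=
  Sum.elim (fun i => b₁ * ι (θ (Matrix.single i₀ i 1))) (fun i => b₂ * ι (θ (Matrix.single i₀ i 1)))

/-- The elements of `A` whose right action on `V` modulo `K` is given by `σ`. -/
def intertwiner (ι : A →ₐ[ℂ] B) (σ : A →ₐ[ℂ] Matrix (n ⊕ n) (n ⊕ n) ℂ) (K : Submodule ℂ B)
    (hKr : ∀ k ∈ K, ∀ a, k * ι a ∈ K) (V : n ⊕ n → B) : Subalgebra ℂ A where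
  carrier := {a | ∀ i, V i * ι a - ∑ j, σ a i j • V j ∈ K}
  mul_mem' := by
    intro a b ha hb i
    have h1 := hKr _ (ha i) b
    have h2 : ∑ j, σ a i j • (V j * ι b - ∑ k, σ b j k • V k) ∈ K :=
      K.sum_mem fun j _ => K.smul_mem _ (hb j)
    have := K.add_mem h1 h2
    convert this using 1
    simp only [map_mul, Matrix.mul_apply, Finset.sum_smul, smul_sub, Finset.sum_sub_distrib,
      Finset.smul_sum, smul_smul, sub_mul, Finset.sum_mul, smul_mul_assoc, mul_assoc]
    rw [Finset.sum_comm]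
    abel
  add_mem' := by
    intro a b ha hb i
    convert K.add_mem (ha i) (hb i) using 1
    simp only [map_add, Matrix.add_apply, add_smul, Finset.sum_add_distrib, mul_add]
    abel
  algebraMap_mem' := by
    intro c i
    convert K.zero_mem using 1
    rcases i with i | i <;> simp [Algebra.algebraMap_eq_smul_one, Matrix.one_apply]

theorem isClosed_intertwiner [TopologicalSpace A] (hι : Continuous ι) (hσ : Continuous σ)
    {K : Submodule ℂ B} (hK : IsClosed (K : Set B)) (hKr : ∀ k ∈ K, ∀ a, k * ι a ∈ K)
    (V : n ⊕ n → B) : IsClosed (intertwiner ι σ K hKr V : Set A) := by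
  have : (intertwiner ι σ K hKr V : Set A) =
      ⋂ i, (fun a => V i * ι a - ∑ j, σ a i j • V j) ⁻¹' (K : Set B) := by
    ext a
    simp [intertwiner]
  rw [this]
  refine isClosed_iInter fun i => hK.preimage ?_
  fun_prop

theorem rowVec_mul_sub_mem [TopologicalSpace A] (hA : IsTwoIdempotentAlgebra θ r s)
    (hσ : IsSymbol θ r s z w σ) (hι : Continuous ι) {K : Submodule ℂ B} (hK : IsClosed (K : Set B))
    (hKr : ∀ k ∈ K, ∀ a, k * ι a ∈ K) {b₁ b₂ : B} (hb : IsSymbolPair (ι r) (ι s) z w K b₁ b₂)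
    (i₀ : n) (a : A) (i : n ⊕ n) :
    rowVec θ ι b₁ b₂ i₀ i * ι a - ∑ j, σ a i j • rowVec θ ι b₁ b₂ i₀ j ∈ K := by
  have hcr (c) : ι (θ c) * ι r = ι r * ι (θ c) := by rw [← map_mul, hA.comm_r, map_mul]
  have hcs (c) : ι (θ c) * ι s = ι s * ι (θ c) := by rw [← map_mul, hA.comm_s, map_mul]
  refine hA.mem_of_isClosed (intertwiner ι σ K hKr (rowVec θ ι b₁ b₂ i₀))
    (isClosed_intertwiner hι hσ.continuous hK hKr _) ?_ ?_ ?_ a i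
  · intro c i
    have hsingle (i : n) : Matrix.single i₀ i 1 * c = ∑ j, c i j • Matrix.single i₀ j (1 : ℂ) := by
      ext k l
      by_cases hk : k = i₀
      · subst hk
        simp [Matrix.sum_apply, Matrix.single_apply]
      · simp [Matrix.sum_apply, hk, Ne.symm hk]
    have (b : B) (i : n) : b * ι (θ (Matrix.single i₀ i 1)) * ι (θ c) =
        ∑ j, c i j • (b * ι (θ (Matrix.single i₀ j 1))) := by
      rw [mul_assoc, ← map_mul, ← map_mul, hsingle]
      simp only [map_sum, map_smul, Finset.mul_sum, mul_smul_comm]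
    rcases i with i | i <;> simp [rowVec, hσ.map_θ, this]
  · rintro (i | i)
    · convert hKr _ hb.fst_r (θ (Matrix.single i₀ i 1)) using 1
      simp [rowVec, hσ.map_r, Matrix.one_apply, sub_mul, mul_assoc, hcr]
    · convert hKr _ hb.snd_r (θ (Matrix.single i₀ i 1)) using 1
      simp [rowVec, hσ.map_r, mul_assoc, hcr]
  · rintro (i | i)
    · convert hKr _ hb.fst_s (θ (Matrix.single i₀ i 1)) using 1
      simp [rowVec, hσ.map_s, Matrix.one_apply, sub_mul, add_mul, mul_assoc, hcs]
    · convert hKr _ hb.snd_s (θ (Matrix.single i₀ i 1)) using 1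
      simp [rowVec, hσ.map_s, Matrix.one_apply, sub_mul, add_mul, mul_assoc, hcs]

/-- A linear combination of the entries of all the row vectors lies in `K` only if the
corresponding combinations of `b₁` and `b₂` do. -/
theorem smul_add_smul_mem_of_sum_rowVec_mem {K : Submodule ℂ B}
    (hKr : ∀ k ∈ K, ∀ a, k * ι a ∈ K) {b₁ b₂ : B} {u : n ⊕ n → ℂ}
    (hu : ∀ i₀, ∑ j, u j • rowVec θ ι b₁ b₂ i₀ j ∈ K) (i : n) :
    u (.inl i) • b₁ + u (.inr i) • b₂ ∈ K := by
  have key : ∑ i₀, (∑ j, u j • rowVec θ ι b₁ b₂ i₀ j) * ι (θ (Matrix.single i i₀ 1)) ∈ K :=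
    K.sum_mem fun i₀ _ => hKr _ (hu i₀) _
  convert key using 1
  have hmul (b : B) (i₀ j : n) : b * ι (θ (Matrix.single i₀ j 1)) * ι (θ (Matrix.single i i₀ 1)) =
      if j = i then b * ι (θ (Matrix.single i₀ i₀ 1)) else 0 := by
    rw [mul_assoc, ← map_mul, ← map_mul]
    split_ifs with h
    · subst h; simp
    · simp [Matrix.single_mul_single_of_ne _ _ _ _ h]
  have hone : ∑ i₀, ι (θ (Matrix.single i₀ i₀ 1)) = 1 := by
    rw [← map_sum, ← map_sum, Matrix.sum_single_one, map_one, map_one]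
  simp only [rowVec, Fintype.sum_sum_type, Sum.elim_inl, Sum.elim_inr, add_mul, Finset.sum_mul,
    smul_mul_assoc, hmul, smul_ite, smul_zero, Finset.sum_ite_eq', Finset.mem_univ, if_true,
    Finset.sum_add_distrib, ← Finset.smul_sum, ← Finset.mul_sum, hone, mul_one]

end Intertwining

section Localization

variable {B : Type*} [NormedRing B] [NormedAlgebra ℂ B] [CompleteSpace B]

/-- A central element of a Banach algebra is a scalar modulo each maximal left ideal. -/
theorem exists_sub_algebraMap_mem_of_isMaximal {x : B} (hx : ∀ b, x * b = b * x) (L : Ideal B)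
    [hL : L.IsMaximal] : ∃ z ∈ spectrum ℂ x, x - algebraMap ℂ B z ∈ L := by
  suffices h : ∃ z : ℂ, x - algebraMap ℂ B z ∈ L by
    obtain ⟨z, hz⟩ := h
    refine ⟨z, fun hu => hL.ne_top (L.eq_top_of_isUnit_mem hz ?_), hz⟩
    simpa using hu.neg
  by_contra! hmem
  have exists_add_mul_eq {y : B} (hyL : y ∉ L) (b : B) : ∃ l ∈ L, ∃ d, l + d * y = b := by
    have : L ⊔ Ideal.span {y} = ⊤ := by
      refine hL.1.2 _ (lt_of_le_of_ne le_sup_left fun h => hyL ?_)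
      rw [h]
      exact Ideal.mem_sup_right (Ideal.mem_span_singleton_self y)
    obtain ⟨l, hl, c, hc, hlc⟩ := Submodule.mem_sup.1 (this ▸ Submodule.mem_top : b ∈ _)
    obtain ⟨d, rfl⟩ := Ideal.mem_span_singleton'.1 hc
    exact ⟨l, hl, d, hlc⟩
  let L' : Submodule ℂ B := L.restrictScalars ℂ
  have : IsClosed (L' : Set B) := Ideal.IsMaximal.isClosed (I := L)
  have hLx : L' ≤ L'.comap (LinearMap.mulLeft ℂ x) := fun b hb => L.mul_mem_left x hb
  let T : (B ⧸ L') →L[ℂ] (B ⧸ L') :=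
    { L'.mapQ L' (LinearMap.mulLeft ℂ x) hLx with
      cont := L'.isQuotientMap_mkQ.continuous_iff.2 <|
        L'.isQuotientMap_mkQ.continuous.comp (continuous_const_mul x) }
  have hT (b : B) : T (Submodule.Quotient.mk b) = Submodule.Quotient.mk (x * b) := rfl
  have : Nontrivial (B ⧸ L') := by
    refine Submodule.Quotient.nontrivial_iff.2 fun h => hL.ne_top ?_
    exact (Submodule.restrictScalars_eq_top_iff ℂ B B).1 h
  obtain ⟨z, hz⟩ := spectrum.nonempty T
  refine hz ?_
  rw [spectrum.mem_resolventSet_iff, ContinuousLinearMap.isUnit_iff_bijective]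
  set y := x - algebraMap ℂ B z with hy
  have hyc (b : B) : y * b = b * y := by
    rw [hy, sub_mul, mul_sub, hx, Algebra.commutes]
  have hTz (b : B) : (algebraMap ℂ (B ⧸ L' →L[ℂ] B ⧸ L') z - T) (Submodule.Quotient.mk b) =
      Submodule.Quotient.mk (-(y * b)) := by
    rw [_root_.sub_apply, hT, Algebra.algebraMap_eq_smul_one,
      _root_.smul_apply, one_apply_eq_self, ← Submodule.Quotient.mk_smul,
      ← Submodule.Quotient.mk_sub, hy, sub_mul, ← Algebra.smul_def, neg_sub]
  constructor
  · rw [injective_iff_map_eq_zero]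
    intro q
    obtain ⟨b, rfl⟩ := Submodule.Quotient.mk_surjective _ q
    rw [hTz, Submodule.Quotient.mk_eq_zero, neg_mem_iff, Submodule.Quotient.mk_eq_zero]
    intro hb
    by_contra hbL
    obtain ⟨l, hl, d, hd⟩ := exists_add_mul_eq hbL 1
    refine hmem z ?_
    rw [← hy, ← mul_one y, ← hd, mul_add, ← mul_assoc, hyc d, mul_assoc]
    exact L.add_mem (L.mul_mem_left _ hl) (L.mul_mem_left _ hb)
  · intro q
    obtain ⟨b, rfl⟩ := Submodule.Quotient.mk_surjective _ q
    obtain ⟨l, hl, d, rfl⟩ := exists_add_mul_eq (hmem z) b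
    refine ⟨Submodule.Quotient.mk (-d), ?_⟩
    rw [hTz, Submodule.Quotient.eq, mul_neg, neg_neg, hyc, sub_add_cancel_right]
    exact L.neg_mem hl

end Localization

section Invertibility

variable {n A B : Type*} [Fintype n] [DecidableEq n] [Ring A] [Algebra ℂ A]
  [NormedRing B] [NormedAlgebra ℂ B] {ι : A →ₐ[ℂ] B}

/-- The largest subspace of a left ideal which is stable under right multiplication by `A`. -/
def rightStableCore (ι : A →ₐ[ℂ] B) (L : Ideal B) : Submodule ℂ B where
  carrier := {b | ∀ a, b * ι a ∈ L}
  add_mem' := fun hb hc a => by simpa [add_mul] using L.add_mem (hb a) (hc a)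
  zero_mem' := fun a => by simp
  smul_mem' := fun c b hb a => by
    simpa [Algebra.smul_def, mul_assoc] using L.mul_mem_left (algebraMap ℂ B c) (hb a)

theorem mul_mem_rightStableCore {L : Ideal B} {k : B} (hk : k ∈ rightStableCore ι L) (a : A) :
    k * ι a ∈ rightStableCore ι L := fun a' => by
  rw [mul_assoc, ← map_mul]
  exact hk _

theorem rightStableCore_le {L : Ideal B} {k : B} (hk : k ∈ rightStableCore ι L) : k ∈ L := by
  simpa using hk 1

theorem isClosed_rightStableCore {L : Ideal B} (hL : IsClosed (L : Set B)) :
    IsClosed (rightStableCore ι L : Set B) := by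
  have : (rightStableCore ι L : Set B) = ⋂ a, (fun b => b * ι a) ⁻¹' (L : Set B) := by
    ext b
    simp [rightStableCore]
  rw [this]
  exact isClosed_iInter fun a => hL.preimage (continuous_mul_const _)

variable [TopologicalSpace A] {θ : Matrix n n ℂ →ₐ[ℂ] A} {r s : A}

theorem IsSymbolPair.mem_rightStableCore [Nonempty n] {z w : ℂ}
    {σ : A →ₐ[ℂ] Matrix (n ⊕ n) (n ⊕ n) ℂ} (hA : IsTwoIdempotentAlgebra θ r s)
    (hσ : IsSymbol θ r s z w σ) (hι : Continuous ι) {L : Ideal B} (hL : IsClosed (L : Set B))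
    {a : A} (haL : ι a ∈ L) (ha : (σ a).det ≠ 0) {b₁ b₂ : B}
    (hb : IsSymbolPair (ι r) (ι s) z w (rightStableCore ι L) b₁ b₂) :
    b₁ ∈ rightStableCore ι L ∧ b₂ ∈ rightStableCore ι L := by
  have hrel := rowVec_mul_sub_mem hA hσ hι (isClosed_rightStableCore hL)
    (fun k hk a => mul_mem_rightStableCore hk a) hb
  have hsmul (c : ℂ) {b : B} (hb : b ∈ L) : c • b ∈ L := (L.restrictScalars ℂ).smul_mem c hb
  have hVL (i₀ i) : rowVec θ ι b₁ b₂ i₀ i ∈ L := by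
    have hsum (j) : ∑ k, σ a j k • rowVec θ ι b₁ b₂ i₀ k ∈ L := by
      simpa using L.sub_mem (L.mul_mem_left (rowVec θ ι b₁ b₂ i₀ j) haL)
        (rightStableCore_le (hrel i₀ a j))
    have hinv : (σ a)⁻¹ * σ a = 1 := Matrix.nonsing_inv_mul _ (isUnit_iff_ne_zero.2 ha)
    have key : ∑ j, (σ a)⁻¹ i j • ∑ k, σ a j k • rowVec θ ι b₁ b₂ i₀ k ∈ L :=
      L.sum_mem fun j _ => hsmul _ (hsum j)
    simp only [Finset.smul_sum, smul_smul] at key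
    rw [Finset.sum_comm] at key
    simp only [← Finset.sum_smul, ← Matrix.mul_apply, hinv, Matrix.one_apply, ite_smul, one_smul,
      zero_smul, Finset.sum_ite_eq, Finset.mem_univ, if_true] at key
    exact key
  have hVK (i₀ i) : rowVec θ ι b₁ b₂ i₀ i ∈ rightStableCore ι L := fun a' => by
    have h := L.sum_mem (t := Finset.univ) fun j _ => hsmul (σ a' i j) (hVL i₀ j)
    simpa only [sub_add_cancel] using L.add_mem (rightStableCore_le (hrel i₀ a' i)) h
  obtain ⟨i⟩ := ‹Nonempty n›
  have hcomb (u : n ⊕ n → ℂ) := smul_add_smul_mem_of_sum_rowVec_mem (u := u)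
    (fun k hk a => mul_mem_rightStableCore hk a)
    (fun i₀ => Submodule.sum_mem _ fun j _ => Submodule.smul_mem _ (u j) (hVK i₀ j)) i
  exact ⟨by simpa using hcomb (Sum.elim 1 0), by simpa using hcomb (Sum.elim 0 1)⟩

variable [CompleteSpace B] {x : B} {w : ℂ → ℂ}
    {σ : ℂ → A →ₐ[ℂ] Matrix (n ⊕ n) (n ⊕ n) ℂ}

theorem exists_mul_eq_one_of_det_ne_zero [Nonempty n] (hA : IsTwoIdempotentAlgebra θ r s)
    (hι : Continuous ι) (hx : x = 1 - ι r - ι s + ι r * ι s + ι s * ι r) (hxc : ∀ b, x * b = b * x)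
    (hσ : ∀ z ∈ spectrum ℂ x, IsSymbol θ r s z (w z) (σ z)) {a : A}
    (ha : ∀ z ∈ spectrum ℂ x, (σ z a).det ≠ 0) : ∃ b, b * ι a = 1 := by
  rw [← Ideal.mem_span_singleton']
  by_contra hne
  obtain ⟨L, hL, haL⟩ := Ideal.exists_le_maximal _ ((Ideal.ne_top_iff_one _).2 hne)
  replace haL : ι a ∈ L := haL (Ideal.mem_span_singleton_self _)
  obtain ⟨z, hz, hxz⟩ := exists_sub_algebraMap_mem_of_isMaximal hxc L
  have hLc : IsClosed (L : Set B) := Ideal.IsMaximal.isClosed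
  have hR : ι r * ι r = ι r := by rw [← map_mul, hA.r_idem]
  have hS : ι s * ι s = ι s := by rw [← map_mul, hA.s_idem]
  have hw := (hσ z hz).w_sq
  have hK (b : B) : b * (x - z • 1) ∈ rightStableCore ι L := fun a' => by
    have : b * (x - z • 1) * ι a' = b * ι a' * (x - algebraMap ℂ B z) := by
      simp only [mul_sub, sub_mul, mul_assoc, hxc, Algebra.algebraMap_eq_smul_one]
      simp
    rw [this]
    exact L.mul_mem_left _ hxz
  have h₁ := (isSymbolPair_corner hR hS hx hw hK).mem_rightStableCore hA (hσ z hz) hι hLc haL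
    (ha z hz)
  have h₂ := (isSymbolPair_corner' hR hS hx hw hK).mem_rightStableCore hA (hσ z hz) hι hLc haL
    (ha z hz)
  have h₃ : ι r ∈ rightStableCore ι L ∧ 1 - ι r ∈ rightStableCore ι L := by
    rcases eq_or_ne (w z) 0 with h | h
    · have hσz := hσ z hz
      rw [h] at hσz
      exact (isSymbolPair_of_degenerate hR hx hK h₁.2 h₂.1).mem_rightStableCore hA hσz hι hLc haL
        (ha z hz)
    · exact ⟨(Submodule.smul_mem_iff _ h).1 h₁.1, (Submodule.smul_mem_iff _ h).1 h₂.2⟩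
  refine hL.ne_top ((Ideal.eq_top_iff_one _).2 (rightStableCore_le (ι := ι) ?_))
  simpa using Submodule.add_mem _ h₃.1 h₃.2

open MulOpposite in
theorem isUnit_of_det_ne_zero [Nonempty n] (hA : IsTwoIdempotentAlgebra θ r s)
    (hι : Continuous ι) (hx : x = 1 - ι r - ι s + ι r * ι s + ι s * ι r) (hxc : ∀ b, x * b = b * x)
    (hσ : ∀ z ∈ spectrum ℂ x, IsSymbol θ r s z (w z) (σ z)) {a : A}
    (ha : ∀ z ∈ spectrum ℂ x, (σ z a).det ≠ 0) : IsUnit (ι a) := by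
  obtain ⟨b, hb⟩ := exists_mul_eq_one_of_det_ne_zero hA hι hx hxc hσ ha
  let θ' : Matrix n n ℂ →ₐ[ℂ] Aᵐᵒᵖ :=
    (AlgHom.op θ).comp (Matrix.transposeAlgEquiv n ℂ ℂ).toAlgHom
  let σ' (z : ℂ) : Aᵐᵒᵖ →ₐ[ℂ] Matrix (n ⊕ n) (n ⊕ n) ℂ :=
    (Matrix.transposeAlgEquiv (n ⊕ n) ℂ ℂ).symm.toAlgHom.comp (AlgHom.op (σ z))
  have hθ' (c) : θ' c = op (θ c.transpose) := rfl
  have hσ'_apply (z a) : σ' z (op a) = (σ z a).transpose := rfl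
  have hA' : IsTwoIdempotentAlgebra θ' (op r) (op s) :=
    { r_idem := by rw [← op_mul, hA.r_idem]
      s_idem := by rw [← op_mul, hA.s_idem]
      comm_r := fun c => by rw [hθ', ← op_mul, ← op_mul, hA.comm_r]
      comm_s := fun c => by rw [hθ', ← op_mul, ← op_mul, hA.comm_s]
      mem_of_isClosed := fun S hS hSθ hSr hSs a =>
        hA.mem_of_isClosed S.unop (hS.preimage continuous_op)
          (fun c => by simpa [hθ'] using hSθ c.transpose) hSr hSs a.unop }
  have hspec : spectrum ℂ (op x) ⊆ spectrum ℂ x := fun z hz hu => hz <| by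
    rw [spectrum.mem_resolventSet_iff] at hu ⊢
    exact hu.op
  have hσ' : ∀ z ∈ spectrum ℂ (op x), IsSymbol θ' (op r) (op s) z (w z) (σ' z) := fun z hz =>
    have h := hσ z (hspec hz)
    { continuous := (h.continuous.comp continuous_unop).matrix_transpose
      w_sq := h.w_sq
      map_θ := fun c => by simp [hθ', hσ'_apply, h.map_θ, Matrix.fromBlocks_transpose]
      map_r := by simp [hσ'_apply, h.map_r, Matrix.fromBlocks_transpose]
      map_s := by simp [hσ'_apply, h.map_s, Matrix.fromBlocks_transpose] }
  obtain ⟨c, hc⟩ := exists_mul_eq_one_of_det_ne_zero (ι := AlgHom.op ι) (a := op a) hA'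
    (continuous_op.comp (hι.comp continuous_unop)) (x := op x)
    (by rw [hx]; simp; abel) (fun b => by
      have := congrArg op (hxc b.unop)
      simpa using this.symm) hσ'
    (fun z hz => by rw [hσ'_apply, Matrix.det_transpose]; exact ha z (hspec hz))
  have hc' : ι a * c.unop = 1 := by simpa using congrArg unop hc
  exact ⟨⟨ι a, b, (left_inv_eq_right_inv hb hc') ▸ hc', hb⟩, rfl⟩

theorem det_ne_zero_of_isUnit (hA : IsTwoIdempotentAlgebra θ r s) (hι : Continuous ι)
    (hx : x = 1 - ι r - ι s + ι r * ι s + ι s * ι r) (hxc : ∀ b, x * b = b * x) {z w : ℂ}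
    (hz : z ∈ spectrum ℂ x) (hz0 : z ≠ 0) (hz1 : z ≠ 1) {σ : A →ₐ[ℂ] Matrix (n ⊕ n) (n ⊕ n) ℂ}
    (hσ : IsSymbol θ r s z w σ) {a : A} (ha : IsUnit (ι a)) : (σ a).det ≠ 0 := by
  intro hdet
  obtain ⟨u, hu0, hu⟩ := Matrix.exists_vecMul_eq_zero_iff.2 hdet
  have hyc (b : B) : b * (x - z • 1) = (x - z • 1) * b := by
    simp [mul_sub, sub_mul, hxc]
  let J : Ideal B := (Ideal.span {x - z • 1}).closure
  have hJ1 : (1 : B) ∉ J := by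
    rw [← Ideal.ne_top_iff_one]
    refine Ideal.closure_ne_top _ fun htop => hz ?_
    obtain ⟨b, hb⟩ := Ideal.mem_span_singleton'.1 ((Ideal.eq_top_iff_one _).1 htop)
    rw [spectrum.mem_resolventSet_iff, ← neg_sub, IsUnit.neg_iff, Algebra.algebraMap_eq_smul_one]
    exact ⟨⟨_, b, by rw [← hyc, hb], hb⟩, rfl⟩
  have hJc : IsClosed (J : Set B) := isClosed_closure
  have hyJ (b : B) : b * (x - z • 1) ∈ J :=
    subset_closure (Ideal.mem_span_singleton'.2 ⟨b, rfl⟩)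
  have hJr {k : B} (hk : k ∈ J) (b : B) : k * b ∈ J := by
    refine closure_minimal (t := (fun k => k * b) ⁻¹' (J : Set B)) ?_
      (hJc.preimage (continuous_mul_const b)) hk
    intro k hk
    obtain ⟨c, rfl⟩ := Ideal.mem_span_singleton'.1 hk
    rw [Set.mem_preimage, mul_assoc, ← hyc, ← mul_assoc]
    exact hyJ _
  let K : Submodule ℂ B := J.restrictScalars ℂ
  have hKr (k) (hk : k ∈ K) (a : A) : k * ι a ∈ K := hJr hk _
  have hR : ι r * ι r = ι r := by rw [← map_mul, hA.r_idem]
  have hS : ι s * ι s = ι s := by rw [← map_mul, hA.s_idem]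
  have hpair := isSymbolPair_corner (K := K) hR hS hx hσ.w_sq hyJ
  have hw : w ≠ 0 := by
    rintro rfl
    have := hσ.w_sq
    simp [hz0, sub_eq_zero, hz1.symm] at this
  have hsum (i₀) : ∑ j, u j • rowVec θ ι (w • ι r) (ι r * ι s * (1 - ι r)) i₀ j ∈ K := by
    have h₁ : ∑ i, u i • (rowVec θ ι (w • ι r) (ι r * ι s * (1 - ι r)) i₀ i * ι a -
        ∑ j, σ a i j • rowVec θ ι (w • ι r) (ι r * ι s * (1 - ι r)) i₀ j) ∈ K :=
      K.sum_mem fun i _ => K.smul_mem _ (rowVec_mul_sub_mem hA hσ hι hJc hKr hpair i₀ a i)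
    simp only [smul_sub, Finset.sum_sub_distrib, Finset.smul_sum, smul_smul] at h₁
    rw [Finset.sum_comm (f := fun i j => (u i * σ a i j) • _)] at h₁
    have hu' (j) : ∑ i, u i * σ a i j = 0 := congrFun hu j
    simp only [← Finset.sum_smul, hu', zero_smul, Finset.sum_const_zero, sub_zero,
      ← smul_mul_assoc, ← Finset.sum_mul] at h₁
    obtain ⟨v, hv⟩ := ha
    have := hJr h₁ (↑v⁻¹ : B)
    rwa [← hv, Units.mul_inv_cancel_right] at this
  have hcomb := smul_add_smul_mem_of_sum_rowVec_mem hKr hsum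
  have hcorner : ι r * ι s * (1 - ι r) * ι r = 0 := by simp [mul_assoc, sub_mul, hR]
  have hrJ : ι r ∈ K := by
    obtain ⟨i, hi⟩ := Function.ne_iff.1 hu0
    have hu1 (i) : u (.inl i) • w • ι r ∈ K := by
      have := hJr (hcomb i) (ι r)
      rwa [add_mul, smul_mul_assoc, smul_mul_assoc, smul_mul_assoc, hcorner, hR, smul_zero,
        add_zero] at this
    rcases i with i | i
    · exact (K.smul_mem_iff hw).1 ((K.smul_mem_iff hi).1 (hu1 i))
    · have h₁ : ι r * ι s * (1 - ι r) ∈ K := by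
        refine (K.smul_mem_iff hi).1 ?_
        simpa using K.sub_mem (hcomb i) (hu1 i)
      have h₂ := K.sub_mem (hKr _ h₁ s) hpair.snd_s
      rw [sub_sub_cancel] at h₂
      have h₃ := K.sub_mem h₂ (K.smul_mem (1 - z) h₁)
      rw [add_sub_cancel_right] at h₃
      exact (K.smul_mem_iff hw).1 ((K.smul_mem_iff hw).1 h₃)
  have hsz : (1 - z) • (1 : B) - ι s ∈ K := by
    have h₁ := hyJ 1
    have h₂ := K.sub_mem (K.sub_mem (K.add_mem h₁ hrJ) (hKr _ hrJ s)) (J.mul_mem_left (ι s) hrJ)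
    convert h₂ using 1
    rw [hx, one_mul]
    module
  have hsJ : ι s ∈ K := by
    have := hKr _ hsz s
    rw [sub_mul, hS, smul_mul_assoc, one_mul, sub_smul, one_smul, sub_sub_cancel_left] at this
    exact (K.smul_mem_iff hz0).1 (by simpa using this)
  refine hJ1 ((K.smul_mem_iff (sub_ne_zero.2 hz1.symm)).1 ?_)
  simpa using K.add_mem hsz hsJ

theorem Multiset.pow_card_le_norm_prod {δ : ℝ} (hδ : 0 ≤ δ) (m : Multiset ℂ)
    (hm : ∀ μ ∈ m, δ ≤ ‖μ‖) : δ ^ m.card ≤ ‖m.prod‖ := by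
  induction m using Multiset.induction_on with
  | empty => simp
  | cons μ m ih =>
    rw [Multiset.card_cons, Multiset.prod_cons, norm_mul, pow_succ']
    exact mul_le_mul (hm μ (Multiset.mem_cons_self μ m))
      (ih fun ν hν => hm ν (Multiset.mem_cons_of_mem hν)) (by positivity) (norm_nonneg _)

theorem exists_pow_le_norm_det (hA : IsTwoIdempotentAlgebra θ r s) (hι : Continuous ι)
    (hx : x = 1 - ι r - ι s + ι r * ι s + ι s * ι r) (hxc : ∀ b, x * b = b * x)
    (hσ : ∀ z ∈ spectrum ℂ x, IsSymbol θ r s z (w z) (σ z)) {a : A} (ha : IsUnit (ι a)) :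
    ∃ δ > 0, ∀ a', ι a' ∈ Metric.ball (ι a) δ → ∀ z ∈ spectrum ℂ x, z ≠ 0 → z ≠ 1 →
      δ ^ Fintype.card (n ⊕ n) ≤ ‖(σ z a').det‖ := by
  obtain ⟨ε, hε, hball⟩ := Metric.isOpen_iff.1 Units.isOpen (ι a) ha
  refine ⟨ε / (1 + ‖(1 : B)‖), by positivity, fun a' ha' z hz hz0 hz1 => ?_⟩
  rw [Matrix.det_eq_prod_roots_charpoly, ← (σ z a').charpoly_natDegree_eq_dim,
    ← Polynomial.splits_iff_card_roots.1 (IsAlgClosed.splits (σ z a').charpoly)]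
  refine Multiset.pow_card_le_norm_prod (by positivity) _ fun μ hμ => ?_
  by_contra! hlt
  have hdet : (σ z (algebraMap ℂ A μ - a')).det = 0 := by
    have := (Polynomial.mem_roots'.1 hμ).2
    rw [Polynomial.IsRoot.def, Matrix.eval_charpoly] at this
    rw [map_sub, AlgHom.commutes, ← this]
    rfl
  refine det_ne_zero_of_isUnit hA hι hx hxc hz hz0 hz1 (hσ z hz) ?_ hdet
  rw [← IsUnit.neg_iff, ← map_neg, neg_sub]
  refine hball ?_
  rw [Metric.mem_ball, dist_eq_norm] at ha' ⊢
  calc ‖ι (a' - algebraMap ℂ A μ) - ι a‖ = ‖(ι a' - ι a) - μ • 1‖ := by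
        rw [map_sub, AlgHom.commutes, Algebra.algebraMap_eq_smul_one]
        abel_nf
    _ ≤ ‖ι a' - ι a‖ + ‖μ‖ * ‖(1 : B)‖ := (norm_sub_le _ _).trans_eq (by rw [norm_smul])
    _ < ε / (1 + ‖(1 : B)‖) + ε / (1 + ‖(1 : B)‖) * ‖(1 : B)‖ :=
        add_lt_add_of_lt_of_le ha' (by gcongr)
    _ = ε := by field_simp

/-- The elements of `A` whose symbol is continuous at `z₀` along `Ω`. -/
def continuousSymbolAt (σ : ℂ → A →ₐ[ℂ] Matrix (n ⊕ n) (n ⊕ n) ℂ) (Ω : Set ℂ) (z₀ : ℂ) :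
    Subalgebra ℂ A where
  carrier := {a | Tendsto (fun z => σ z a) (𝓝[Ω] z₀) (𝓝 (σ z₀ a))}
  mul_mem' := fun ha hb => by simpa using Tendsto.mul ha hb
  add_mem' := fun ha hb => by simpa using Tendsto.add ha hb
  algebraMap_mem' := fun c => by simp [AlgHom.commutes, tendsto_const_nhds]

theorem dense_continuousSymbolAt [IsTopologicalRing A] (hA : IsTwoIdempotentAlgebra θ r s)
    {Ω : Set ℂ} (hσ : ∀ z ∈ Ω, IsSymbol θ r s z (w z) (σ z)) {z₀ : ℂ} (hz₀ : z₀ ∈ Ω)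
    (hz : z₀ * (1 - z₀) = 0) : Dense (continuousSymbolAt σ Ω z₀ : Set A) := by
  have hw₀ : w z₀ = 0 := mul_self_eq_zero.1 ((hσ z₀ hz₀).w_sq.trans hz)
  have hid : Tendsto (fun z : ℂ => z) (𝓝[Ω] z₀) (𝓝 z₀) := tendsto_id.mono_left nhdsWithin_le_nhds
  have hw : Tendsto w (𝓝[Ω] z₀) (𝓝 (w z₀)) := by
    have h : Tendsto (fun z => √‖z * (1 - z)‖) (𝓝[Ω] z₀) (𝓝 √‖z₀ * (1 - z₀)‖) :=
      (hid.mul (tendsto_const_nhds.sub hid)).norm.sqrt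
    rw [hz, norm_zero, Real.sqrt_zero] at h
    rw [hw₀, tendsto_zero_iff_norm_tendsto_zero]
    refine h.congr' (eventually_nhdsWithin_of_forall fun z hzΩ => ?_)
    rw [← (hσ z hzΩ).w_sq, norm_mul, Real.sqrt_mul_self (norm_nonneg _)]
  intro a
  refine hA.mem_of_isClosed (continuousSymbolAt σ Ω z₀).topologicalClosure
    (Subalgebra.isClosed_topologicalClosure _) (fun c => ?_) ?_ ?_ a <;>
    refine Subalgebra.le_topologicalClosure _ ?_
  · refine (tendsto_const_nhds (x := σ z₀ (θ c))).congr'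
      (eventually_nhdsWithin_of_forall fun z hzΩ => ?_)
    exact ((hσ z₀ hz₀).map_θ c).trans ((hσ z hzΩ).map_θ c).symm
  · refine (tendsto_const_nhds (x := σ z₀ r)).congr'
      (eventually_nhdsWithin_of_forall fun z hzΩ => ?_)
    exact (hσ z₀ hz₀).map_r.trans (hσ z hzΩ).map_r.symm
  · have hcont : Continuous fun p : ℂ × ℂ => Matrix.fromBlocks (p.1 • (1 : Matrix n n ℂ))
        (p.2 • (1 : Matrix n n ℂ)) (p.2 • (1 : Matrix n n ℂ)) ((1 - p.1) • (1 : Matrix n n ℂ)) := by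
      refine Continuous.matrix_fromBlocks ?_ ?_ ?_ ?_ <;> fun_prop
    have := (hcont.tendsto (z₀, w z₀)).comp (hid.prodMk_nhds hw)
    change Tendsto (fun z => σ z s) (𝓝[Ω] z₀) (𝓝 (σ z₀ s))
    rw [(hσ z₀ hz₀).map_s]
    refine this.congr' (eventually_nhdsWithin_of_forall fun z hzΩ => ?_)
    exact (hσ z hzΩ).map_s.symm

theorem det_ne_zero_of_isUnit_of_accPt [IsTopologicalRing A] (hA : IsTwoIdempotentAlgebra θ r s)
    (hι : Continuous ι) (hx : x = 1 - ι r - ι s + ι r * ι s + ι s * ι r)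
    (hxc : ∀ b, x * b = b * x) (hσ : ∀ z ∈ spectrum ℂ x, IsSymbol θ r s z (w z) (σ z)) {z₀ : ℂ}
    (hz₀ : z₀ ∈ spectrum ℂ x) (hz : z₀ * (1 - z₀) = 0) (hacc : AccPt z₀ (𝓟 (spectrum ℂ x)))
    {a : A} (ha : IsUnit (ι a)) : (σ z₀ a).det ≠ 0 := by
  obtain ⟨δ, hδ, hbound⟩ := exists_pow_le_norm_det hA hι hx hxc hσ ha
  suffices h : δ ^ Fintype.card (n ⊕ n) ≤ ‖(σ z₀ a).det‖ from
    norm_pos_iff.1 ((pow_pos hδ _).trans_le h)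
  have hclosed : IsClosed {b | δ ^ Fintype.card (n ⊕ n) ≤ ‖(σ z₀ b).det‖} :=
    isClosed_le continuous_const (hσ z₀ hz₀).continuous.matrix_det.norm
  have hmem := (dense_continuousSymbolAt hA hσ hz₀ hz).open_subset_closure_inter
    (Metric.isOpen_ball.preimage hι) (Metric.mem_ball_self hδ : a ∈ ι ⁻¹' Metric.ball (ι a) δ)
  refine closure_minimal (fun b hb => ?_) hclosed hmem
  obtain ⟨hball, hcont⟩ := hb
  have hne : ∀ᶠ z in 𝓝[≠] z₀, z ≠ 0 ∧ z ≠ 1 := by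
    rcases mul_eq_zero.1 hz with rfl | h
    · exact eventually_mem_nhdsWithin.and
        (eventually_nhdsWithin_of_eventually_nhds (isOpen_ne.eventually_mem zero_ne_one))
    · obtain rfl : 1 = z₀ := sub_eq_zero.1 h
      exact (eventually_nhdsWithin_of_eventually_nhds (isOpen_ne.eventually_mem one_ne_zero)).and
        eventually_mem_nhdsWithin
  have hdet : Tendsto (fun z => ‖(σ z b).det‖) (𝓝[spectrum ℂ x] z₀) (𝓝 ‖(σ z₀ b).det‖) :=
    ((continuous_id.matrix_det.tendsto _).comp hcont).norm
  have : NeBot (𝓝[≠] z₀ ⊓ 𝓟 (spectrum ℂ x)) := hacc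
  have hle : 𝓝[≠] z₀ ⊓ 𝓟 (spectrum ℂ x) ≤ 𝓝[spectrum ℂ x] z₀ :=
    inf_le_inf_right _ nhdsWithin_le_nhds
  refine ge_of_tendsto (hdet.mono_left hle) ?_
  filter_upwards [hne.filter_mono inf_le_left, mem_inf_of_right (mem_principal_self _)] with z h hzx
  exact hbound b hball z hzx h.1 h.2

/-- The symbol criterion for invertibility when `x` is central. -/
theorem isUnit_iff_forall_det_ne_zero [IsTopologicalRing A] [Nonempty n]
    (hA : IsTwoIdempotentAlgebra θ r s) (hι : Continuous ι)
    (hx : x = 1 - ι r - ι s + ι r * ι s + ι s * ι r) (hxc : ∀ b, x * b = b * x)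
    (h0 : (0 : ℂ) ∈ spectrum ℂ x → AccPt (0 : ℂ) (𝓟 (spectrum ℂ x)))
    (h1 : (1 : ℂ) ∈ spectrum ℂ x → AccPt (1 : ℂ) (𝓟 (spectrum ℂ x)))
    (hσ : ∀ z ∈ spectrum ℂ x, IsSymbol θ r s z (w z) (σ z)) (a : A) :
    IsUnit (ι a) ↔ ∀ z ∈ spectrum ℂ x, (σ z a).det ≠ 0 := by
  refine ⟨fun ha z hz => ?_, isUnit_of_det_ne_zero hA hι hx hxc hσ⟩
  by_cases hz0 : z = 0
  · subst hz0
    exact det_ne_zero_of_isUnit_of_accPt hA hι hx hxc hσ hz (by simp) (h0 hz) ha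
  by_cases hz1 : z = 1
  · subst hz1
    exact det_ne_zero_of_isUnit_of_accPt hA hι hx hxc hσ hz (by simp) (h1 hz) ha
  exact det_ne_zero_of_isUnit hA hι hx hxc hz hz0 hz1 (hσ z hz) ha

end Invertibility

section Centralizer

variable {B : Type*} [Ring B] [Algebra ℂ B] {x : B}

theorem isUnit_centralizer_iff {b : Subalgebra.centralizer ℂ {x}} : IsUnit b ↔ IsUnit (b : B) := by
  refine ⟨fun h => h.map (Subalgebra.centralizer ℂ {x}).val, fun h => ?_⟩
  obtain ⟨u, hu⟩ := h
  have hcomm : Commute x u := by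
    rw [hu]
    exact Subalgebra.mem_centralizer_iff ℂ |>.1 b.2 x rfl
  refine isUnit_iff_exists.2 ⟨⟨↑u⁻¹, Subalgebra.mem_centralizer_iff ℂ |>.2 ?_⟩,
    Subtype.ext ?_, Subtype.ext ?_⟩
  · rintro _ rfl
    exact hcomm.units_inv_right
  · simp [← hu]
  · simp [← hu]

theorem spectrum_centralizer (b : Subalgebra.centralizer ℂ {x}) :
    spectrum ℂ b = spectrum ℂ (b : B) := by
  ext z
  rw [spectrum.mem_iff, spectrum.mem_iff, isUnit_centralizer_iff]
  rfl

end Centralizer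

theorem Subalgebra.mem_of_isClosed_of_subset {B : Type*} [Ring B] [Algebra ℂ B]
    [TopologicalSpace B] [IsTopologicalRing B] {X : Set B} {A : Subalgebra ℂ B}
    (hA : A = (Algebra.adjoin ℂ X).topologicalClosure) {S : Subalgebra ℂ A}
    (hS : IsClosed (S : Set A)) (hX : ∀ a : A, (a : B) ∈ X → a ∈ S) (a : A) : a ∈ S := by
  have hAclosed : IsClosed (A : Set B) := hA ▸ Subalgebra.isClosed_topologicalClosure _
  have hXA : X ⊆ A := fun b hb =>
    hA ▸ Subalgebra.le_topologicalClosure _ (Algebra.subset_adjoin hb)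
  have hle : A ≤ S.map A.val := by
    conv_lhs => rw [hA]
    refine Subalgebra.topologicalClosure_minimal
      (Algebra.adjoin_le fun b hb => ⟨⟨b, hXA hb⟩, hX _ hb, rfl⟩) ?_
    exact hAclosed.isClosedMap_subtype_val _ hS
  obtain ⟨a', ha', h⟩ := hle a.2
  obtain rfl : a' = a := Subtype.ext h
  exact ha'

open Filter in
/-- **Two projections theorem, part (b).** In the setting of the two projections theorem,
suppose that for each `z` in the spectrum of `x` in `B` we are given a continuous unital
algebra homomorphism `σ z : A → ℂ^{2N×2N}` satisfying `σ z (θ c) = [[c, 0], [0, c]]`,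
`σ z r = [[E, 0], [0, 0]]` and `σ z s = [[zE, wE], [wE, (1-z)E]]` for some complex number
`w = w z` with `w² = z(1 - z)`. Then `a ∈ A` is invertible in `B` if and only if
`det (σ z a) ≠ 0` for every `z` in the spectrum of `x` in `B`. -/
theorem two_projections_theorem_b
    {B : Type*} [NormedRing B] [NormedAlgebra ℂ B] [CompleteSpace B]
    (N : ℕ) (hN : 0 < N)
    (𝒞 : Subalgebra ℂ B) (h𝒞closed : IsClosed (𝒞 : Set B))
    (θ : Matrix (Fin N) (Fin N) ℂ ≃ₐ[ℂ] 𝒞)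
    (r s : B) (hr : r ^ 2 = r) (hs : s ^ 2 = s)
    (hrc : ∀ c ∈ 𝒞, c * r = r * c) (hsc : ∀ c ∈ 𝒞, c * s = s * c)
    (A : Subalgebra ℂ B)
    (hA : A = (Algebra.adjoin ℂ ((𝒞 : Set B) ∪ {r, s})).topologicalClosure)
    (x : B) (hx : x = r * s * r + (1 - r) * (1 - s) * (1 - r))
    (h0 : (0 : ℂ) ∈ spectrum ℂ x → AccPt (0 : ℂ) (𝓟 (spectrum ℂ x)))
    (h1 : (1 : ℂ) ∈ spectrum ℂ x → AccPt (1 : ℂ) (𝓟 (spectrum ℂ x)))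
    (σ : ℂ → (A →ₐ[ℂ] Matrix (Fin N ⊕ Fin N) (Fin N ⊕ Fin N) ℂ))
    (w : ℂ → ℂ)
    (hσcont : ∀ z ∈ spectrum ℂ x, Continuous (σ z))
    (hσθ : ∀ z ∈ spectrum ℂ x, ∀ c : Matrix (Fin N) (Fin N) ℂ, ∀ a : A,
      (a : B) = (θ c : B) → σ z a = Matrix.fromBlocks c 0 0 c)
    (hσr : ∀ z ∈ spectrum ℂ x, ∀ a : A,
      (a : B) = r → σ z a = Matrix.fromBlocks 1 0 0 0)
    (hw : ∀ z ∈ spectrum ℂ x, (w z) ^ 2 = z * (1 - z))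
    (hσs : ∀ z ∈ spectrum ℂ x, ∀ a : A, (a : B) = s →
      σ z a = Matrix.fromBlocks (z • 1) (w z • 1) (w z • 1) ((1 - z) • 1))
    (a : A) :
    IsUnit (a : B) ↔ ∀ z ∈ spectrum ℂ x, (σ z a).det ≠ 0 := by
  have hsub : ∀ b ∈ (𝒞 : Set B) ∪ {r, s}, b ∈ A := fun b hb =>
    hA ▸ Subalgebra.le_topologicalClosure _ (Algebra.subset_adjoin hb)
  have h𝒞A : ∀ c ∈ 𝒞, c ∈ A := fun c hc => hsub c (Or.inl hc)
  have hrA : r ∈ A := hsub r (by simp)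
  have hsA : s ∈ A := hsub s (by simp)
  have hrr : r * r = r := by rw [← pow_two, hr]
  have hss : s * s = s := by rw [← pow_two, hs]
  have hx' : x = 1 - r - s + r * s + s * r := by
    have : x = r * s * r + (1 - r - s + r * s - r + r * r + s * r - r * s * r) := by
      rw [hx]
      noncomm_ring
    rw [this, hrr]
    abel
  have hAx : A ≤ Subalgebra.centralizer ℂ {x} := by
    rw [hA]
    refine Subalgebra.topologicalClosure_minimal (Algebra.adjoin_le ?_)
      (Set.isClosed_centralizer _)
    intro b hb
    refine (Subalgebra.mem_centralizer_iff ℂ).2 ?_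
    intro y hy
    rw [Set.mem_singleton_iff.1 hy]
    change Commute x b
    rcases hb with hb | rfl | rfl
    · have hbr : Commute b r := hrc b hb
      have hbs : Commute b s := hsc b hb
      rw [hx']
      exact (((((Commute.one_right b).sub_right hbr).sub_right hbs).add_right
        (hbr.mul_right hbs)).add_right (hbs.mul_right hbr)).symm
    · rw [hx', commute_iff_eq]
      simp only [mul_add, add_mul, mul_sub, sub_mul, one_mul, mul_one, mul_assoc, hrr]
      simp only [← mul_assoc, hrr]
      abel
    · rw [hx', commute_iff_eq]
      simp only [mul_add, add_mul, mul_sub, sub_mul, one_mul, mul_one, mul_assoc, hss]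
      simp only [← mul_assoc, hss]
      abel
  have : CompleteSpace (Subalgebra.centralizer ℂ {x}) :=
    (Set.isClosed_centralizer {x}).completeSpace_coe
  have : Nonempty (Fin N) := ⟨⟨0, hN⟩⟩
  let θA : Matrix (Fin N) (Fin N) ℂ →ₐ[ℂ] A := (Subalgebra.inclusion h𝒞A).comp θ.toAlgHom
  have hθA (c) : (θA c : B) = θ c := rfl
  have hgen : IsTwoIdempotentAlgebra θA (⟨r, hrA⟩ : A) ⟨s, hsA⟩ := by
    refine ⟨Subtype.ext hrr, Subtype.ext hss, fun c => Subtype.ext (hrc _ (θ c).2),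
      fun c => Subtype.ext (hsc _ (θ c).2), fun S hS hθS hrS hsS => ?_⟩
    refine Subalgebra.mem_of_isClosed_of_subset hA hS ?_
    rintro ⟨b, hbA⟩ (hb | rfl | rfl)
    · obtain ⟨c, hc⟩ := θ.surjective ⟨b, hb⟩
      convert hθS c
      exact (congrArg Subtype.val hc).symm
    · exact hrS
    · exact hsS
  let x' : Subalgebra.centralizer ℂ {x} :=
    ⟨x, (Subalgebra.mem_centralizer_iff ℂ).2 (fun y hy => by rw [Set.mem_singleton_iff.1 hy])⟩
  have hspec : spectrum ℂ x' = spectrum ℂ x := spectrum_centralizer x'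
  have hσ : ∀ z ∈ spectrum ℂ x', IsSymbol θA (⟨r, hrA⟩ : A) ⟨s, hsA⟩ z (w z) (σ z) := by
    rw [hspec]
    exact fun z hz => ⟨hσcont z hz, by rw [← pow_two, hw z hz], fun c => hσθ z hz c _ (hθA c),
      hσr z hz _ rfl, hσs z hz _ rfl⟩
  rw [← hspec] at h0 h1 ⊢
  exact isUnit_centralizer_iff.symm.trans (isUnit_iff_forall_det_ne_zero
    (ι := Subalgebra.inclusion hAx) hgen (continuous_inclusion hAx) (Subtype.ext hx')
    (fun b => Subtype.ext ((Subalgebra.mem_centralizer_iff ℂ).1 b.2 x rfl)) h0 h1 hσ a)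
end

section
/- Two projections theorem, part (c): The algebra A is inverse closed in B (that is, every element of A which is invertible in B has its inverse in A) if and only if the spectrum of x in A coincides with the spectrum of x in B. -/
open Polynomial in
/-- A model of the algebra generated by a matrix algebra and two idempotents `r`, `s` commuting
with it: `φ` evaluates polynomials with matrix coefficients at `1 - (r - s) ^ 2`. -/
structure TwoIdempotentModel {k R n : Type*} [Field k] [Ring R] [Algebra k R] [Fintype n]
    [DecidableEq n] (φ : Matrix n n k[X] →ₐ[k] R) (r s : R) : Prop where
  idem_left : r * r = r
  idem_right : s * s = s
  comm_left : ∀ p, Commute (φ p) r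
  comm_right : ∀ p, Commute (φ p) s
  map_X : φ ((X : k[X]) • 1) = 1 - r - s + r * s + s * r

namespace TwoIdempotentModel

open Polynomial Matrix

section Algebraic

variable {k R n : Type*} [Field k] [Ring R] [Algebra k R] [Fintype n] [DecidableEq n]

/-- The element of `R` with Peirce components `p`, `q`, `t`, `u` relative to `r`. -/
noncomputable def val (φ : Matrix n n k[X] →ₐ[k] R) (r s : R) (p q t u : Matrix n n k[X]) : R :=
  φ p * r + φ q * (r * s * (1 - r)) + φ t * ((1 - r) * s * r) + φ u * (1 - r)

/-- The matrix `M` represents the element `a` of `R`. -/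
def Represents (φ : Matrix n n k[X] →ₐ[k] R) (r s : R) (M : Matrix (n ⊕ n) (n ⊕ n) k[X])
    (a : R) : Prop :=
  ∃ p q t u, M = fromBlocks p q ((X * (1 - X) : k[X]) • t) u ∧ a = val φ r s p q t u

variable {φ : Matrix n n k[X] →ₐ[k] R} {r s : R}

theorem map_smul_one_mul (c : k[X]) (p : Matrix n n k[X]) : φ (c • p) = φ (c • 1) * φ p := by
  rw [← map_mul, smul_mul_assoc, one_mul]

theorem weight_ne_zero : (X * (1 - X) : k[X]) ≠ 0 :=
  mul_ne_zero X_ne_zero (sub_ne_zero.2 (by simpa using (X_ne_C (1 : k)).symm))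

theorem map_weight (h : TwoIdempotentModel φ r s) :
    φ ((X * (1 - X) : k[X]) • 1) =
      (1 - r - s + r * s + s * r) * (1 - (1 - r - s + r * s + s * r)) := by
  rw [mul_smul, map_smul_one_mul, h.map_X, sub_smul, one_smul, map_sub, map_one, h.map_X]

theorem upper_mul_lower (h : TwoIdempotentModel φ r s) :
    (r * s * (1 - r)) * ((1 - r) * s * r) = φ ((X * (1 - X) : k[X]) • 1) * r := by
  have h1 := h.idem_left
  have h2 := h.idem_right
  have h3 : ∀ a, r * (r * a) = r * a := fun a => by rw [← mul_assoc, h1]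
  have h4 : ∀ a, s * (s * a) = s * a := fun a => by rw [← mul_assoc, h2]
  rw [h.map_weight]
  simp only [mul_add, add_mul, mul_sub, sub_mul, mul_assoc, one_mul, mul_one, h1, h2, h3, h4]
  abel

theorem lower_mul_upper (h : TwoIdempotentModel φ r s) :
    ((1 - r) * s * r) * (r * s * (1 - r)) = φ ((X * (1 - X) : k[X]) • 1) * (1 - r) := by
  have h1 := h.idem_left
  have h2 := h.idem_right
  have h3 : ∀ a, r * (r * a) = r * a := fun a => by rw [← mul_assoc, h1]
  have h4 : ∀ a, s * (s * a) = s * a := fun a => by rw [← mul_assoc, h2]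
  rw [h.map_weight]
  simp only [mul_add, add_mul, mul_sub, sub_mul, mul_assoc, one_mul, mul_one, h1, h2, h3, h4]
  abel

theorem val_mul (h : TwoIdempotentModel φ r s) (p q t u p' q' t' u' : Matrix n n k[X]) :
    val φ r s p q t u * val φ r s p' q' t' u' =
      val φ r s (p * p' + (X * (1 - X) : k[X]) • (q * t')) (p * q' + q * u')
        (t * p' + u * t') ((X * (1 - X) : k[X]) • (t * q') + u * u') := by
  have h1 := h.idem_left
  have h1' : (1 - r) * (1 - r) = 1 - r := by simp [mul_sub, sub_mul, h1]
  have h10 : r * (1 - r) = 0 := by simp [mul_sub, h1]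
  have h01 : (1 - r) * r = 0 := by simp [sub_mul, h1]
  have hul := h.upper_mul_lower
  have hlu := h.lower_mul_upper
  have cr : ∀ y, Commute r (φ y) := fun y => (h.comm_left y).symm
  have cs : ∀ y, Commute s (φ y) := fun y => (h.comm_right y).symm
  have cr' : ∀ y, Commute (1 - r) (φ y) := fun y => (Commute.one_left _).sub_left (cr y)
  have cu : ∀ y, Commute (r * s * (1 - r)) (φ y) := fun y =>
    ((cr y).mul_left (cs y)).mul_left (cr' y)
  have cl : ∀ y, Commute ((1 - r) * s * r) (φ y) := fun y =>
    ((cr' y).mul_left (cs y)).mul_left (cr y)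
  have hru : r * (r * s * (1 - r)) = r * s * (1 - r) := by simp only [← mul_assoc, h1]
  have hrl : r * ((1 - r) * s * r) = 0 := by simp only [← mul_assoc, h10, zero_mul]
  have hur : (r * s * (1 - r)) * r = 0 := by rw [mul_assoc, h01, mul_zero]
  have huu : (r * s * (1 - r)) * (r * s * (1 - r)) = 0 := by
    rw [mul_assoc, ← mul_assoc (1 - r), ← mul_assoc (1 - r), h01]; simp
  have hur' : (r * s * (1 - r)) * (1 - r) = r * s * (1 - r) := by rw [mul_assoc, h1']
  have hlr : ((1 - r) * s * r) * r = (1 - r) * s * r := by rw [mul_assoc, h1]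
  have hll : ((1 - r) * s * r) * ((1 - r) * s * r) = 0 := by
    rw [mul_assoc, ← mul_assoc r, ← mul_assoc r, h10]; simp
  have hlr' : ((1 - r) * s * r) * (1 - r) = 0 := by rw [mul_assoc, h10, mul_zero]
  have hru' : (1 - r) * (r * s * (1 - r)) = 0 := by simp only [← mul_assoc, h01, zero_mul]
  have hrl' : (1 - r) * ((1 - r) * s * r) = (1 - r) * s * r := by simp only [← mul_assoc, h1']
  have hz : ∀ y, φ ((X * (1 - X) : k[X]) • y) = φ y * φ ((X * (1 - X) : k[X]) • 1) := fun y => by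
    rw [← map_mul, mul_smul_comm, mul_one]
  unfold val
  generalize r * s * (1 - r) = e at *
  generalize (1 - r) * s * r = f at *
  generalize 1 - r = r' at *
  generalize φ ((X * (1 - X) : k[X]) • 1) = w at *
  simp only [map_add, hz, map_mul]
  simp only [mul_add, add_mul, (cr _).mul_mul_mul_comm, (cr' _).mul_mul_mul_comm,
    (cu _).mul_mul_mul_comm, (cl _).mul_mul_mul_comm, h1, h1', h10, h01, hru, hrl, hur, huu, hur',
    hlr, hll, hlr', hru', hrl', hul, hlu, mul_zero, add_zero, zero_add]
  simp only [mul_assoc]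
  abel

theorem Represents.add {M M' : Matrix (n ⊕ n) (n ⊕ n) k[X]} {a a' : R}
    (hM : Represents φ r s M a) (hM' : Represents φ r s M' a') :
    Represents φ r s (M + M') (a + a') := by
  obtain ⟨p, q, t, u, rfl, rfl⟩ := hM
  obtain ⟨p', q', t', u', rfl, rfl⟩ := hM'
  refine ⟨p + p', q + q', t + t', u + u', by rw [fromBlocks_add, smul_add], ?_⟩
  simp only [val, map_add, add_mul]
  abel

theorem Represents.mul (h : TwoIdempotentModel φ r s) {M M' : Matrix (n ⊕ n) (n ⊕ n) k[X]}
    {a a' : R} (hM : Represents φ r s M a) (hM' : Represents φ r s M' a') :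
    Represents φ r s (M * M') (a * a') := by
  obtain ⟨p, q, t, u, rfl, rfl⟩ := hM
  obtain ⟨p', q', t', u', rfl, rfl⟩ := hM'
  refine ⟨_, _, _, _, ?_, h.val_mul p q t u p' q' t' u'⟩
  rw [fromBlocks_multiply, smul_add, mul_smul_comm, smul_mul_assoc, smul_mul_assoc, mul_smul_comm]

theorem Represents.smul {M : Matrix (n ⊕ n) (n ⊕ n) k[X]} {a : R} (c : k[X])
    (hM : Represents φ r s M a) : Represents φ r s (c • M) (φ (c • 1) * a) := by
  obtain ⟨p, q, t, u, rfl, rfl⟩ := hM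
  refine ⟨c • p, c • q, c • t, c • u, by rw [fromBlocks_smul, smul_comm], ?_⟩
  simp only [val, map_smul_one_mul c p, map_smul_one_mul c q, map_smul_one_mul c t,
    map_smul_one_mul c u, mul_add, mul_assoc]

theorem Represents.neg {M : Matrix (n ⊕ n) (n ⊕ n) k[X]} {a : R}
    (hM : Represents φ r s M a) : Represents φ r s (-M) (-a) := by
  simpa using hM.smul (-1)

theorem represents_diagonal (p : Matrix n n k[X]) :
    Represents φ r s (fromBlocks p 0 0 p) (φ p) :=
  ⟨p, 0, 0, p, by simp, by simp [val, ← mul_add]⟩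

theorem represents_one : Represents φ r s 1 1 := by
  simpa using represents_diagonal (φ := φ) (r := r) (s := s) 1

theorem represents_smul_one (c : k[X]) : Represents φ r s (c • 1) (φ (c • 1)) := by
  simpa using (represents_one (φ := φ) (r := r) (s := s)).smul c

theorem represents_left : Represents φ r s (fromBlocks 1 0 0 0) r :=
  ⟨1, 0, 0, 0, by simp, by simp [val]⟩

theorem represents_right (h : TwoIdempotentModel φ r s) :
    ∃ M, Represents φ r s M s := by
  refine ⟨_, (X : k[X]) • 1, 1, 1, 1 - (X : k[X]) • 1, rfl, ?_⟩
  have h1 := h.idem_left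
  simp only [val, map_sub, map_one, h.map_X]
  simp only [add_mul, mul_sub, sub_mul, mul_assoc, one_mul, mul_one, h1]
  abel

theorem Represents.unique {M : Matrix (n ⊕ n) (n ⊕ n) k[X]} {a b : R}
    (ha : Represents φ r s M a) (hb : Represents φ r s M b) : a = b := by
  obtain ⟨p, q, t, u, hM, rfl⟩ := ha
  obtain ⟨p', q', t', u', hM', rfl⟩ := hb
  obtain ⟨rfl, rfl, ht, rfl⟩ := fromBlocks_inj.1 (hM.symm.trans hM')
  have hz : (X * (1 - X) : k[X]) ≠ 0 := weight_ne_zero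
  obtain rfl : t = t' := by
    ext1 i j
    have := congrFun₂ ht i j
    simpa [hz] using this
  rfl

theorem Represents.exists_aeval (h : TwoIdempotentModel φ r s)
    {M : Matrix (n ⊕ n) (n ⊕ n) k[X]} {a : R} (hM : Represents φ r s M a) (f : k[X][X]) :
    ∃ b, Represents φ r s (aeval M f) b := by
  induction f using Polynomial.induction_on' with
  | add f g hf hg =>
    obtain ⟨b, hb⟩ := hf
    obtain ⟨c, hc⟩ := hg
    exact ⟨b + c, by simpa using hb.add hc⟩
  | monomial m c =>
    have hpow : Represents φ r s (M ^ m) (a ^ m) := by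
      induction m with
      | zero => simpa using represents_one
      | succ m ih => simpa [pow_succ] using ih.mul h hM
    exact ⟨_, by simpa [aeval_monomial, Algebra.smul_def] using hpow.smul c⟩

/-- An element represented by `M` divides the value at `φ (X • 1)` of the determinant of `M`. -/
theorem Represents.exists_mul_eq_det (h : TwoIdempotentModel φ r s)
    {M : Matrix (n ⊕ n) (n ⊕ n) k[X]} {a : R} (hM : Represents φ r s M a) :
    ∃ G b, Represents φ r s G b ∧ a * b = φ (M.det • 1) := by
  obtain ⟨b, hb⟩ := hM.exists_aeval h
    (-(C ((-1) ^ Fintype.card (n ⊕ n)) * M.charpoly.divX))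
  have key : M * aeval M (-(C ((-1) ^ Fintype.card (n ⊕ n)) * M.charpoly.divX)) = M.det • 1 := by
    have hch := M.aeval_self_charpoly
    rw [← divX_mul_X_add M.charpoly, map_add, map_mul, aeval_X, aeval_C] at hch
    have h2 := eq_neg_of_add_eq_zero_left hch
    have hcomm : M * aeval M M.charpoly.divX = aeval M M.charpoly.divX * M := by
      simpa using ((commute_X M.charpoly.divX).map (aeval M)).eq
    rw [map_neg, map_mul, aeval_C, ← Algebra.smul_def, mul_neg, mul_smul_comm, hcomm, h2,
      det_eq_sign_charpoly_coeff, Algebra.algebraMap_eq_smul_one, smul_neg, neg_neg, smul_smul]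
  exact ⟨_, b, hb, (hM.mul h hb).unique (key ▸ represents_smul_one _)⟩

theorem Represents.commute (h : TwoIdempotentModel φ r s)
    {M : Matrix (n ⊕ n) (n ⊕ n) k[X]} {a : R} (hM : Represents φ r s M a) (c : k[X]) :
    Commute (φ (c • 1)) a := by
  have h1 := (represents_smul_one c).mul h hM
  have h2 := hM.mul h (represents_smul_one c)
  rw [smul_one_mul] at h1
  rw [mul_smul_one] at h2
  exact h1.unique h2

theorem Represents.exists_eq_mul_of_eval_eq_zero {μ : k} (hμ : (X * (1 - X) : k[X]).eval μ ≠ 0)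
    {M : Matrix (n ⊕ n) (n ⊕ n) k[X]} {a : R} (hM : Represents φ r s M a)
    (h0 : M.map (eval μ) = 0) :
    ∃ G b, Represents φ r s G b ∧ a = φ ((X - C μ : k[X]) • 1) * b := by
  have hdiv : ∀ p : Matrix n n k[X], p.map (eval μ) = 0 → ∃ p', p = (X - C μ : k[X]) • p' := by
    intro p hp
    have : ∀ i j, ∃ c, p i j = (X - C μ) * c := fun i j =>
      dvd_iff_isRoot.2 (congrFun₂ hp i j)
    choose p' hp' using this
    exact ⟨of p', by ext1 i j; simpa using hp' i j⟩
  obtain ⟨p, q, t, u, rfl, rfl⟩ := hM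
  rw [fromBlocks_map, ← fromBlocks_zero, fromBlocks_inj] at h0
  obtain ⟨hp, hq, ht, hu⟩ := h0
  obtain ⟨p', rfl⟩ := hdiv p hp
  obtain ⟨q', rfl⟩ := hdiv q hq
  obtain ⟨u', rfl⟩ := hdiv u hu
  obtain ⟨t', rfl⟩ := hdiv t (by
    ext1 i j
    have := congrFun₂ ht i j
    rw [map_apply, Matrix.smul_apply, smul_eq_mul, eval_mul] at this
    exact (mul_eq_zero.1 this).resolve_left hμ)
  refine ⟨_, _, ⟨p', q', t', u', rfl, rfl⟩, ?_⟩
  simp only [val, map_smul_one_mul _ p', map_smul_one_mul _ q', map_smul_one_mul _ t',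
    map_smul_one_mul _ u', mul_add, mul_assoc]

theorem exists_represents_eval {μ : k} (hμ : (X * (1 - X) : k[X]).eval μ ≠ 0)
    (m : Matrix (n ⊕ n) (n ⊕ n) k) :
    ∃ M a, Represents φ r s M a ∧ M.map (eval μ) = m := by
  refine ⟨_, _, ⟨m.toBlocks₁₁.map C, m.toBlocks₁₂.map C,
    (((X * (1 - X) : k[X]).eval μ)⁻¹ • m.toBlocks₂₁).map C, m.toBlocks₂₂.map C, rfl, rfl⟩, ?_⟩
  conv_rhs => rw [← fromBlocks_toBlocks m]
  rw [fromBlocks_map, fromBlocks_inj]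
  refine ⟨by ext; simp, by ext; simp, ?_, by ext; simp⟩
  ext1 i j
  rw [map_apply, Matrix.smul_apply, smul_eq_mul, eval_mul, map_apply, eval_C,
    Matrix.smul_apply, smul_eq_mul, mul_inv_cancel_left₀ hμ]

theorem map_eval_mul (μ : k) {l : Type*} [Fintype l] (M M' : Matrix l l k[X]) :
    (M * M').map (eval μ) = M.map (eval μ) * M'.map (eval μ) := by
  simpa using Matrix.map_mul (L := M) (M := M') (f := evalRingHom μ)

theorem Represents.det_eval_ne_zero [Nonempty n] (h : TwoIdempotentModel φ r s) {μ : k}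
    (hμ : (X * (1 - X) : k[X]).eval μ ≠ 0) {M : Matrix (n ⊕ n) (n ⊕ n) k[X]} {a : R}
    (hM : Represents φ r s M a) (ha : IsUnit a) (hnu : ¬ IsUnit (φ ((X - C μ : k[X]) • 1))) :
    M.det.eval μ ≠ 0 := by
  set y := φ ((X - C μ : k[X]) • 1)
  let I : TwoSidedIdeal (Matrix (n ⊕ n) (n ⊕ n) k) := TwoSidedIdeal.mk'
    {m | ∃ L l b, Represents φ r s L l ∧ L.map (eval μ) = m ∧ Commute y b ∧ l = y * b}
    ⟨0, 0, 0, by simpa using (represents_one (φ := φ) (r := r) (s := s)).smul 0, by ext; simp,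
      Commute.zero_right _, by simp⟩
    (by
      rintro _ _ ⟨L, l, b, hL, rfl, hb, rfl⟩ ⟨L', l', b', hL', rfl, hb', rfl⟩
      exact ⟨_, _, b + b', hL.add hL', by ext; simp, hb.add_right hb', by rw [mul_add]⟩)
    (by
      rintro _ ⟨L, l, b, hL, rfl, hb, rfl⟩
      exact ⟨_, _, -b, hL.neg, by ext; simp, hb.neg_right, by rw [mul_neg]⟩)
    (by
      rintro m _ ⟨L, l, b, hL, rfl, hb, rfl⟩
      obtain ⟨M', c, hM', rfl⟩ := exists_represents_eval (φ := φ) (r := r) (s := s) hμ m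
      have hc := hM'.commute h (X - C μ)
      exact ⟨_, _, c * b, hM'.mul h hL, map_eval_mul _ _ _, hc.mul_right hb, by
        rw [← mul_assoc, ← mul_assoc, hc.eq]⟩)
    (by
      rintro _ m ⟨L, l, b, hL, rfl, hb, rfl⟩
      obtain ⟨M', c, hM', rfl⟩ := exists_represents_eval (φ := φ) (r := r) (s := s) hμ m
      have hc := hM'.commute h (X - C μ)
      exact ⟨_, _, b * c, hL.mul h hM', map_eval_mul _ _ _, hb.mul_right hc, by
        rw [mul_assoc]⟩)
  have hI : I = ⊥ := by
    refine (eq_bot_or_eq_top I).resolve_right fun hI => hnu ?_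
    have h1 : (1 : Matrix (n ⊕ n) (n ⊕ n) k) ∈ I := hI ▸ trivial
    rw [TwoSidedIdeal.mem_mk'] at h1
    obtain ⟨L, l, b, hL, hL1, hb, rfl⟩ := h1
    obtain ⟨G, g, hG, hg⟩ := (represents_one.add hL.neg).exists_eq_mul_of_eval_eq_zero hμ (by
      rw [← sub_eq_zero.2 hL1.symm]
      ext i j
      by_cases hij : i = j <;> simp [hij, one_apply, sub_eq_add_neg])
    have hyg : Commute y g := hG.commute h _
    have h1 : y * (b + g) = 1 := by rw [mul_add, ← hg]; abel
    exact ⟨⟨y, b + g, h1, by rw [← (hb.add_right hyg).eq, h1]⟩, rfl⟩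
  intro hdet
  have hdet' : (M.map (eval μ)).det = 0 := by
    rw [← hdet]; exact ((evalRingHom μ).map_det M).symm
  obtain ⟨v, hv, hMv⟩ := exists_mulVec_eq_zero_iff.2 hdet'
  let m : Matrix (n ⊕ n) (n ⊕ n) k := of fun i _ => v i
  have hMm : M.map (eval μ) * m = 0 := by
    ext i j
    exact congrFun hMv i
  have hm : m ∈ I := by
    rw [TwoSidedIdeal.mem_mk']
    obtain ⟨L, l, hL, hLm⟩ := exists_represents_eval (φ := φ) (r := r) (s := s) hμ m
    obtain ⟨G, g, hG, hg⟩ := (hM.mul h hL).exists_eq_mul_of_eval_eq_zero hμ (by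
      rw [map_eval_mul, hLm, hMm])
    obtain ⟨a, rfl⟩ := ha
    have hya : Commute y ↑a⁻¹ := (hM.commute h _).units_inv_right
    refine ⟨L, l, ↑a⁻¹ * g, hL, hLm, hya.mul_right (hG.commute h _), ?_⟩
    rw [← mul_assoc, hya.eq, mul_assoc, ← hg, Units.inv_mul_cancel_left]
  rw [hI, TwoSidedIdeal.mem_bot] at hm
  obtain ⟨i, hi⟩ := Function.ne_iff.1 hv
  exact hi (congrFun₂ hm i i)

theorem map_X_sub_C (μ : k) :
    φ ((X - C μ : k[X]) • 1) = φ ((X : k[X]) • 1) - algebraMap k R μ := by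
  have : (C μ : k[X]) • (1 : Matrix n n k[X]) = algebraMap k _ μ := by
    rw [Algebra.algebraMap_eq_smul_one, ← algebraMap_smul k[X] μ]; rfl
  rw [sub_smul, map_sub, this, AlgHom.commutes]

theorem map_smul_one_eq_aeval (p : k[X]) : φ (p • 1) = aeval (φ ((X : k[X]) • 1)) p := by
  have := aeval_algHom_apply (φ.comp (IsScalarTower.toAlgHom k k[X] (Matrix n n k[X]))) X p
  simpa [Algebra.algebraMap_eq_smul_one] using this.symm

theorem Represents.mem {A : Subalgebra k R} (hφ : ∀ p, φ p ∈ A) (hr : r ∈ A) (hs : s ∈ A)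
    {M : Matrix (n ⊕ n) (n ⊕ n) k[X]} {a : R} (hM : Represents φ r s M a) : a ∈ A := by
  obtain ⟨p, q, t, u, rfl, rfl⟩ := hM
  have hr' := A.sub_mem A.one_mem hr
  exact A.add_mem (A.add_mem (A.add_mem (A.mul_mem (hφ p) hr)
    (A.mul_mem (hφ q) (A.mul_mem (A.mul_mem hr hs) hr')))
    (A.mul_mem (hφ t) (A.mul_mem (A.mul_mem hr' hs) hr))) (A.mul_mem (hφ u) hr')

theorem exists_represents_of_mem_adjoin (h : TwoIdempotentModel φ r s) {c : Set R}
    (hc : ∀ a ∈ c, ∃ p, φ p = a) {a : R} (ha : a ∈ Algebra.adjoin k (c ∪ {r, s})) :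
    ∃ M, Represents φ r s M a := by
  induction ha using Algebra.adjoin_induction with
  | mem a ha =>
    obtain ha | rfl | rfl := ha
    · obtain ⟨p, rfl⟩ := hc a ha
      exact ⟨_, represents_diagonal p⟩
    · exact ⟨_, represents_left⟩
    · exact h.represents_right
  | algebraMap c => exact ⟨_, φ.commutes c ▸ represents_diagonal _⟩
  | add a b _ _ ha hb =>
    obtain ⟨M, hM⟩ := ha
    obtain ⟨M', hM'⟩ := hb
    exact ⟨_, hM.add hM'⟩
  | mul a b _ _ ha hb =>
    obtain ⟨M, hM⟩ := ha
    obtain ⟨M', hM'⟩ := hb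
    exact ⟨_, hM.mul h hM'⟩

/-- Two idempotents commuting with a matrix algebra admit a model extending its inclusion. -/
theorem exists_model {r s : R} (hr : r * r = r) (hs : s * s = s) (ψ : Matrix n n k →ₐ[k] R)
    (hψr : ∀ m, Commute (ψ m) r) (hψs : ∀ m, Commute (ψ m) s) :
    ∃ φ : Matrix n n k[X] →ₐ[k] R, TwoIdempotentModel φ r s ∧ (∀ m, φ (m.map C) = ψ m) ∧
      ∀ A : Subalgebra k R, (∀ m, ψ m ∈ A) → r ∈ A → s ∈ A → ∀ p, φ p ∈ A := by
  have hr' : ∀ a, r * (r * a) = r * a := fun a => by rw [← mul_assoc, hr]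
  have hs' : ∀ a, s * (s * a) = s * a := fun a => by rw [← mul_assoc, hs]
  let x := 1 - r - s + r * s + s * r
  have hxr : Commute x r := by
    simp only [x, commute_iff_eq, add_mul, mul_add, mul_sub, sub_mul, mul_assoc, one_mul, mul_one,
      hr, hr']
    abel
  have hxs : Commute x s := by
    simp only [x, commute_iff_eq, add_mul, mul_add, mul_sub, sub_mul, mul_assoc, one_mul, mul_one,
      hs, hs']
    abel
  have hψx : ∀ m, Commute (ψ m) x := fun m =>
    ((((Commute.one_right _).sub_right (hψr m)).sub_right (hψs m)).add_right
      ((hψr m).mul_right (hψs m))).add_right ((hψs m).mul_right (hψr m))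
  let φ : Matrix n n k[X] →ₐ[k] R := (eval₂AlgHom ψ x hψx).comp matPolyEquiv.toAlgHom
  have hφ : ∀ p, φ p = ∑ i ∈ Finset.range ((matPolyEquiv p).natDegree + 1),
      ψ ((matPolyEquiv p).coeff i) * x ^ i := fun p => eval₂_eq_sum_range _ _
  refine ⟨φ, ⟨hr, hs, fun p => ?_, fun p => ?_, ?_⟩, fun m => ?_, fun A hA hrA hsA p => ?_⟩
  · rw [hφ]
    exact Commute.sum_left _ _ _ fun i _ => (hψr _).mul_left (hxr.pow_left i)
  · rw [hφ]
    exact Commute.sum_left _ _ _ fun i _ => (hψs _).mul_left (hxs.pow_left i)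
  · change eval₂ _ _ (matPolyEquiv ((X : k[X]) • 1)) = _
    rw [matPolyEquiv_smul_one, Polynomial.map_X, eval₂_X]
  · change eval₂ _ _ (matPolyEquiv (m.map C)) = _
    rw [matPolyEquiv_map_C, eval₂_C]
    rfl
  · have hxA : x ∈ A := A.add_mem (A.add_mem (A.sub_mem (A.sub_mem A.one_mem hrA) hsA)
      (A.mul_mem hrA hsA)) (A.mul_mem hsA hrA)
    rw [hφ]
    exact A.sum_mem fun i _ => A.mul_mem (hA _) (A.pow_mem hxA i)

end Algebraic

section Analytic

open Filter Topology

variable {B n : Type*} [NormedRing B] [NormedAlgebra ℂ B] [CompleteSpace B] [Fintype n]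
  [DecidableEq n] [Nonempty n] {φ : Matrix n n ℂ[X] →ₐ[ℂ] B} {r s : B}

theorem Represents.exists_le_norm_det_eval (h : TwoIdempotentModel φ r s)
    {M : Matrix (n ⊕ n) (n ⊕ n) ℂ[X]} {a : B} (hM : Represents φ r s M a) (ha : IsUnit a) :
    ∃ ε > 0, ∀ ν ∈ spectrum ℂ (φ ((X : ℂ[X]) • 1)), (X * (1 - X) : ℂ[X]).eval ν ≠ 0 →
      ε ≤ ‖M.det.eval ν‖ := by
  have h0 : (0 : ℂ) ∈ resolventSet ℂ a := by
    rw [spectrum.mem_resolventSet_iff]; simpa using ha.neg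
  obtain ⟨δ, hδ, hball⟩ := Metric.isOpen_iff.1 (spectrum.isOpen_resolventSet (𝕜 := ℂ) a) 0 h0
  refine ⟨δ ^ Fintype.card (n ⊕ n), pow_pos hδ _, fun ν hν hz => ?_⟩
  have hdet : M.det.eval ν = (M.map (eval ν)).det := (evalRingHom ν).map_det M
  have hroots : ∀ l ∈ (M.map (eval ν)).charpoly.roots, δ ≤ ‖l‖ := by
    intro l hl
    by_contra! hlt
    have hl' := (mem_roots'.1 hl).2
    rw [IsRoot.def, eval_charpoly] at hl'
    have hu : IsUnit (algebraMap ℂ B l - a) := by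
      rw [← spectrum.mem_resolventSet_iff]; exact hball (by simpa using hlt)
    have hrep : Represents φ r s ((C l : ℂ[X]) • 1 + -M) (algebraMap ℂ B l - a) := by
      rw [sub_eq_add_neg]
      convert (represents_smul_one (φ := φ) (r := r) (s := s) (C l)).add hM.neg using 2
      have := map_X_sub_C (φ := φ) l
      rw [sub_smul, map_sub] at this
      exact (sub_right_injective this).symm
    refine hrep.det_eval_ne_zero h hz hu ?_ ?_ (μ := ν)
    · rw [map_X_sub_C, IsUnit.sub_iff]; exact hν
    · rw [← hl', ← coe_evalRingHom, RingHom.map_det]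
      congr 1
      ext i j
      by_cases hij : i = j <;> simp [hij, one_apply, sub_eq_add_neg]
  rw [hdet, det_eq_prod_roots_charpoly]
  have hcard : Multiset.card (M.map (eval ν)).charpoly.roots = Fintype.card (n ⊕ n) := by
    rw [IsAlgClosed.card_roots_eq_natDegree, charpoly_natDegree_eq_dim]
  rw [← hcard]
  generalize (M.map (eval ν)).charpoly.roots = S at hroots
  induction S using Multiset.induction_on with
  | empty => simp
  | cons l S ih =>
    rw [Multiset.card_cons, Multiset.prod_cons, norm_mul, pow_succ']
    exact mul_le_mul (hroots l (by simp)) (ih fun l' hl' => hroots l' (by simp [hl']))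
      (by positivity) (norm_nonneg _)

/-- If the zeros of `X * (1 - X)` are not isolated in the spectrum of `φ (X • 1)`, the determinant
representing an invertible element does not vanish on that spectrum. -/
theorem Represents.det_eval_ne_zero_of_accPt (h : TwoIdempotentModel φ r s)
    {M : Matrix (n ⊕ n) (n ⊕ n) ℂ[X]} {a : B} (hM : Represents φ r s M a) (ha : IsUnit a)
    (hacc : ∀ μ ∈ spectrum ℂ (φ ((X : ℂ[X]) • 1)), (X * (1 - X) : ℂ[X]).eval μ = 0 →
      AccPt μ (𝓟 (spectrum ℂ (φ ((X : ℂ[X]) • 1)))))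
    {μ : ℂ} (hμ : μ ∈ spectrum ℂ (φ ((X : ℂ[X]) • 1))) : M.det.eval μ ≠ 0 := by
  obtain ⟨ε, hε, hle⟩ := hM.exists_le_norm_det_eval h ha
  rw [← norm_pos_iff]
  refine hε.trans_le ?_
  by_cases hz : (X * (1 - X) : ℂ[X]).eval μ = 0
  · have : NeBot (𝓝[≠] μ ⊓ 𝓟 (spectrum ℂ (φ ((X : ℂ[X]) • 1)))) := hacc μ hμ hz
    have hne : ∀ᶠ ν in 𝓝[≠] μ, (X * (1 - X) : ℂ[X]).eval ν ≠ 0 := by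
      have hfin := (X * (1 - X) : ℂ[X]).roots.toFinset.finite_toSet
      filter_upwards [nhdsNE_le_cofinite μ hfin.compl_mem_cofinite] with ν hν h0
      exact hν (Multiset.mem_toFinset.2 ((mem_roots weight_ne_zero).2 h0))
    have htend : Tendsto (fun ν => ‖M.det.eval ν‖)
        (𝓝[≠] μ ⊓ 𝓟 (spectrum ℂ (φ ((X : ℂ[X]) • 1)))) (𝓝 ‖M.det.eval μ‖) :=
      (M.det.continuous.norm.tendsto μ).mono_left (inf_le_left.trans inf_le_left)
    refine ge_of_tendsto htend ?_
    filter_upwards [mem_inf_of_left hne, mem_inf_of_right (mem_principal_self _)] with ν h1 h2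
    exact hle ν h2 h1
  · exact hle μ hμ hz

theorem Represents.inverse_mem [Nontrivial B] (h : TwoIdempotentModel φ r s) {A : Subalgebra ℂ B}
    (hφ : ∀ p, φ p ∈ A) (hr : r ∈ A) (hs : s ∈ A) {M : Matrix (n ⊕ n) (n ⊕ n) ℂ[X]} {a : B}
    (hM : Represents φ r s M a) (ha : IsUnit a) {x : A} (hx : (x : B) = φ ((X : ℂ[X]) • 1))
    (hspec : spectrum ℂ x = spectrum ℂ (x : B))
    (h0 : (0 : ℂ) ∈ spectrum ℂ (x : B) → AccPt (0 : ℂ) (𝓟 (spectrum ℂ (x : B))))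
    (h1 : (1 : ℂ) ∈ spectrum ℂ (x : B) → AccPt (1 : ℂ) (𝓟 (spectrum ℂ (x : B)))) :
    Ring.inverse a ∈ A := by
  have hdet : ∀ μ ∈ spectrum ℂ (x : B), M.det.eval μ ≠ 0 := by
    intro μ hμ
    refine hM.det_eval_ne_zero_of_accPt h ha ?_ (hx ▸ hμ)
    rw [← hx]
    intro ν hν hz
    rw [eval_mul, mul_eq_zero, eval_X, eval_sub, eval_one, eval_X, sub_eq_zero] at hz
    obtain rfl | rfl := hz
    exacts [h0 hν, h1 hν]
  have hunit : IsUnit (aeval x M.det) := by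
    rw [← spectrum.zero_notMem_iff ℂ, spectrum.map_polynomial_aeval_of_nonempty _ _
      (hspec ▸ spectrum.nonempty (x : B)), hspec]
    rintro ⟨μ, hμ, hμ0⟩
    exact hdet μ hμ hμ0
  obtain ⟨d, hd⟩ := hunit
  obtain ⟨G, b, hG, hab⟩ := hM.exists_mul_eq_det h
  have hdB : ((d : A) : B) = φ (M.det • 1) := by
    rw [hd, map_smul_one_eq_aeval, ← hx]
    exact (aeval_algHom_apply A.val x M.det).symm
  have hone : a * (b * ((↑d⁻¹ : A) : B)) = 1 := by
    rw [← mul_assoc, hab, ← hdB]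
    exact congrArg Subtype.val d.mul_inv
  obtain ⟨u, rfl⟩ := ha
  rw [Ring.inverse_unit, Units.inv_eq_of_mul_eq_one_right hone]
  exact A.mul_mem (hG.mem hφ hr hs) (↑d⁻¹ : A).2

end Analytic

end TwoIdempotentModel

/-- Inverse closedness of the closure of a subalgebra may be tested on the subalgebra. -/
theorem Subalgebra.isUnit_of_isUnit_coe_topologicalClosure {𝕜 B : Type*} [NormedField 𝕜]
    [NormedRing B] [NormedAlgebra 𝕜 B] [CompleteSpace B] {S : Subalgebra 𝕜 B}
    (hS : ∀ a ∈ S, IsUnit a → Ring.inverse a ∈ S.topologicalClosure)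
    (a : S.topologicalClosure) (ha : IsUnit (a : B)) : IsUnit a := by
  have : (nhdsWithin (a : B) S).NeBot := mem_closure_iff_nhdsWithin_neBot.1 a.2
  have hinv : Ring.inverse (a : B) ∈ S.topologicalClosure := by
    obtain ⟨u, hu⟩ := ha
    have hcont := NormedRing.inverse_continuousAt u
    rw [hu] at hcont
    refine S.isClosed_topologicalClosure.mem_of_tendsto
      (hcont.mono_left (nhdsWithin_le_nhds (s := S))) ?_
    filter_upwards [self_mem_nhdsWithin,
      nhdsWithin_le_nhds (Units.isOpen.mem_nhds ⟨u, hu⟩)] with b hbS hbu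
    exact hS b hbS hbu
  exact ⟨⟨a, ⟨_, hinv⟩, Subtype.ext (Ring.mul_inverse_cancel _ ha),
    Subtype.ext (Ring.inverse_mul_cancel _ ha)⟩, rfl⟩

open Filter in
/-- **Two projections theorem, part (c).** In the setting of the two projections theorem,
the algebra `A` is inverse closed in `B` (every element of `A` invertible in `B` is invertible
in `A`) if and only if the spectrum of `x` in `A` coincides with the spectrum of `x` in `B`. -/
theorem two_projections_theorem_c
    {B : Type*} [NormedRing B] [NormedAlgebra ℂ B] [CompleteSpace B]
    (N : ℕ) (hN : 0 < N)
    (𝒞 : Subalgebra ℂ B) (h𝒞closed : IsClosed (𝒞 : Set B))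
    (θ : Matrix (Fin N) (Fin N) ℂ ≃ₐ[ℂ] 𝒞)
    (r s : B) (hr : r ^ 2 = r) (hs : s ^ 2 = s)
    (hrc : ∀ c ∈ 𝒞, c * r = r * c) (hsc : ∀ c ∈ 𝒞, c * s = s * c)
    (A : Subalgebra ℂ B)
    (hA : A = (Algebra.adjoin ℂ ((𝒞 : Set B) ∪ {r, s})).topologicalClosure)
    (x : B) (hx : x = r * s * r + (1 - r) * (1 - s) * (1 - r))
    (h0 : (0 : ℂ) ∈ spectrum ℂ x → AccPt (0 : ℂ) (𝓟 (spectrum ℂ x)))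
    (h1 : (1 : ℂ) ∈ spectrum ℂ x → AccPt (1 : ℂ) (𝓟 (spectrum ℂ x)))
    (xA : A) (hxA : (xA : B) = x) :
    (∀ a : A, IsUnit (a : B) → IsUnit a) ↔ spectrum ℂ xA = spectrum ℂ x := by
  constructor
  · intro hinv
    ext μ
    rw [spectrum.mem_iff, spectrum.mem_iff, not_iff_not]
    have hcoe : ((algebraMap ℂ A μ - xA : A) : B) = algebraMap ℂ B μ - x := by
      rw [← hxA]; rfl
    rw [← hcoe]
    exact ⟨fun ha => ha.map A.val, hinv _⟩
  intro hspec
  subst hA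
  have : Nonempty (Fin N) := ⟨⟨0, hN⟩⟩
  have : Nontrivial 𝒞 := θ.injective.nontrivial
  have : Nontrivial B := Subtype.val_injective.nontrivial (α := 𝒞)
  rw [pow_two] at hr hs
  obtain ⟨φ, hφ, hφC, hφA⟩ := TwoIdempotentModel.exists_model hr hs (𝒞.val.comp θ.toAlgHom)
    (fun m => hrc _ (θ m).2) (fun m => hsc _ (θ m).2)
  have hxφ : (xA : B) = φ ((Polynomial.X : Polynomial ℂ) • 1) := by
    rw [hxA, hφ.map_X, hx]
    simp only [mul_sub, sub_mul, mul_assoc, one_mul, mul_one, hr]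
    abel
  subst hxA
  set S := Algebra.adjoin ℂ ((𝒞 : Set B) ∪ {r, s})
  have hSA : ∀ a ∈ (𝒞 : Set B) ∪ {r, s}, a ∈ S.topologicalClosure := fun a ha =>
    S.le_topologicalClosure (Algebra.subset_adjoin ha)
  have hrA := hSA r (by simp)
  have hsA := hSA s (by simp)
  refine S.isUnit_of_isUnit_coe_topologicalClosure fun a haS ha => ?_
  obtain ⟨M, hM⟩ := hφ.exists_represents_of_mem_adjoin (fun c hc => ⟨_, by
    rw [hφC (θ.symm ⟨c, hc⟩)]
    exact congrArg Subtype.val (θ.apply_symm_apply ⟨c, hc⟩)⟩) haS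
  exact hM.inverse_mem hφ (hφA _ (fun m => hSA _ (Or.inl (θ m).2)) hrA hsA) hrA hsA ha hxφ hspec
    h0 h1
end
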